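/- arXiv:2601.09122 — 3 statements merged into one kernel-verified Lean document; each statement's English description precedes it below -/
import Mathlib

section
/- Corollary 1 (Bernstein–von Mises theorem in total variation for data-dependent tempering). Let (α_n) be a positive sequence with α_n → 0 and n·α_n → ∞, assume (A0), (A1), (A2) and (A3), assume f_n satisfies Conditions 1 and 2, assume π(θ) ≤ κ for all θ ∈ ℝ^p for some constant κ > 0, and let (α̂_n) be positive random variables with α̂_n/α_n → 1 in P_n-probability. Then the total variation distance d_TV(π_{n,α̂_n}(·|X^n), φ(· | θ̂, (α_n n)^{-1}V^{-1})) := (1/2)·∫_{ℝ^p} |π_{n,α̂_n}(θ|X^n) − φ(θ | θ̂, (α_n n)^{-1}V^{-1})| dθ converges to 0 in P_n-probability, where V is the matrix from (A2). -/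
open MeasureTheory Filter BigOperators

noncomputable section

/-- Multivariate Gaussian density `φ(θ | μ, S)` with mean `μ` and covariance matrix `S`. -/
def gaussDensity (p : ℕ) (μ : EuclideanSpace ℝ (Fin p))
    (S : Matrix (Fin p) (Fin p) ℝ) (θ : EuclideanSpace ℝ (Fin p)) : ℝ :=
  (2 * Real.pi) ^ (-(p : ℝ) / 2) * S.det ^ (-(1 : ℝ) / 2) *
    Real.exp (-(1 / 2) * ∑ i, ∑ j, (θ i - μ i) * S⁻¹ i j * (θ j - μ j))

/-- The tempered (`α`-)posterior density. -/
def post {p : ℕ} {Ω : Type} (L : Ω → EuclideanSpace ℝ (Fin p) → ℝ)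
    (prior : EuclideanSpace ℝ (Fin p) → ℝ) (α : ℝ) (ω : Ω)
    (θ : EuclideanSpace ℝ (Fin p)) : ℝ :=
  L ω θ ^ α * prior θ / ∫ θ', L ω θ' ^ α * prior θ'

/-- Convergence in `P n`-probability of a sequence of random vectors to a constant. -/
def TendstoInProb {Ω : ℕ → Type} [∀ n, MeasurableSpace (Ω n)]
    (P : ∀ n, Measure (Ω n)) {E : Type*} [NormedAddCommGroup E]
    (Y : ∀ n, Ω n → E) (y : E) : Prop :=
  ∀ ε : ℝ, 0 < ε →
    Tendsto (fun n => P n {ω | ε < ‖Y n ω - y‖}) atTop (nhds 0)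

/-- Assumption (A0): consistency and asymptotic normality of the MLE. -/
def A0 {p : ℕ} {Ω : ℕ → Type} [∀ n, MeasurableSpace (Ω n)] (P : ∀ n, Measure (Ω n))
    (θhat : ∀ n, Ω n → EuclideanSpace ℝ (Fin p)) (θstar : EuclideanSpace ℝ (Fin p)) : Prop :=
  TendstoInProb P θhat θstar ∧
  ∃ S : Matrix (Fin p) (Fin p) ℝ, S.IsSymm ∧ S.PosDef ∧
    ∀ f : EuclideanSpace ℝ (Fin p) → ℝ, Continuous f → (∃ C, ∀ x, |f x| ≤ C) →
      Tendsto (fun n => ∫ ω, f ((Real.sqrt n) • (θhat n ω - θstar)) ∂ P n) atTop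
        (nhds (∫ x, f x * gaussDensity p 0 S x))

/-- Assumption (A1): the prior is continuous and positive near `θstar`. -/
def A1 {p : ℕ} (prior : EuclideanSpace ℝ (Fin p) → ℝ)
    (θstar : EuclideanSpace ℝ (Fin p)) : Prop :=
  ∃ δ : ℝ, 0 < δ ∧ ContinuousOn prior (Metric.ball θstar δ) ∧
    ∀ θ ∈ Metric.ball θstar δ, 0 < prior θ

/-- Assumption (A2): tempered local asymptotic normality with matrix `V`. -/
def A2 {p : ℕ} {Ω : ℕ → Type} [∀ n, MeasurableSpace (Ω n)] (P : ∀ n, Measure (Ω n))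
    (L : ∀ n, Ω n → EuclideanSpace ℝ (Fin p) → ℝ)
    (θhat : ∀ n, Ω n → EuclideanSpace ℝ (Fin p)) (θstar : EuclideanSpace ℝ (Fin p))
    (α : ℕ → ℝ) (V : Matrix (Fin p) (Fin p) ℝ) : Prop :=
  V.IsSymm ∧ V.PosDef ∧
  ∀ r : ℝ, 0 < r → ∀ ε : ℝ, 0 < ε →
    Tendsto (fun n => P n {ω | ∃ h : EuclideanSpace ℝ (Fin p), ‖h‖ ≤ r ∧
      ε < |α n * (Real.log (L n ω (θstar + (Real.sqrt (α n * (n : ℝ)))⁻¹ • h)) -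
              Real.log (L n ω θstar))
            - Real.sqrt (α n) *
                ∑ i, ∑ j, h i * V i j * (Real.sqrt n * (θhat n ω j - θstar j))
            + (1 / 2) * ∑ i, ∑ j, h i * V i j * h j|}) atTop (nhds 0)

/-- Assumption (A3): all rescaled posterior moments are bounded in probability. -/
def A3 {p : ℕ} {Ω : ℕ → Type} [∀ n, MeasurableSpace (Ω n)] (P : ∀ n, Measure (Ω n))
    (L : ∀ n, Ω n → EuclideanSpace ℝ (Fin p) → ℝ)
    (prior : EuclideanSpace ℝ (Fin p) → ℝ) (θstar : EuclideanSpace ℝ (Fin p))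
    (α : ℕ → ℝ) : Prop :=
  ∀ ε : ℝ, 0 < ε → ∀ k₀ : ℝ, 0 ≤ k₀ → ∃ M : ℝ, ∃ N : ℕ, ∀ n : ℕ,
    (N : ℝ) ≤ α n * n →
    P n {ω | M < ∫ θ, ‖Real.sqrt (α n * (n : ℝ)) • (θ - θstar)‖ ^ k₀ *
        post (L n) prior (α n) ω θ} < ENNReal.ofReal ε

/-- Conditions 1 and 2 (with a common radius `r`): salience of the pseudo-true parameter
and local quadratic behavior of the log-likelihood near the MLE. -/
def Conds12 {p : ℕ} {Ω : ℕ → Type} [∀ n, MeasurableSpace (Ω n)] (P : ∀ n, Measure (Ω n))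
    (L : ∀ n, Ω n → EuclideanSpace ℝ (Fin p) → ℝ)
    (θhat : ∀ n, Ω n → EuclideanSpace ℝ (Fin p))
    (θstar : EuclideanSpace ℝ (Fin p)) : Prop :=
  ∃ Lc c₀ c₁ c₂ r : ℝ, ∃ γfun : ℝ → ℝ,
    0 < Lc ∧ 0 < c₀ ∧ 0 < c₁ ∧ 0 ≤ c₂ ∧ Real.exp (c₂ / c₀) / c₁ < r ∧
    (∀ v : ℝ, 0 ≤ v → 0 ≤ γfun v) ∧
    (∀ v : ℝ, r ≤ v → c₀ * Real.log (1 + c₁ * v) - c₂ ≤ γfun v) ∧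
    Tendsto (fun n => P n {ω | ∀ θ, r ≤ ‖θ - θstar‖ →
        Real.log (L n ω θ) - Real.log (L n ω θstar) ≤
          -(Lc * (n : ℝ) * γfun ‖θ - θstar‖)}) atTop (nhds 1) ∧
    ∃ c₃ c₄ : ℝ, 0 < c₃ ∧ 0 < c₄ ∧
      Tendsto (fun n => P n {ω | ∀ θ, ‖θ - θhat n ω‖ < 2 * r →
          -((n : ℝ) * c₃ * ‖θ - θhat n ω‖ ^ 2) ≤
              Real.log (L n ω θ) - Real.log (L n ω (θhat n ω)) ∧
            Real.log (L n ω θ) - Real.log (L n ω (θhat n ω)) ≤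
              -((n : ℝ) * c₄ * ‖θ - θhat n ω‖ ^ 2)}) atTop (nhds 1)

/-- Assumption (A1'): the prior is positive and C² near `θstar`, with finite mean. -/
def A1' {p : ℕ} (prior : EuclideanSpace ℝ (Fin p) → ℝ)
    (θstar : EuclideanSpace ℝ (Fin p)) : Prop :=
  (∃ δ : ℝ, 0 < δ ∧ (∀ θ ∈ Metric.ball θstar δ, 0 < prior θ) ∧
    ContDiffOn ℝ 2 prior (Metric.ball θstar δ)) ∧
  Integrable (fun θ : EuclideanSpace ℝ (Fin p) => ‖θ‖ * prior θ)

/-- Assumption (A2'): higher-order tempered LAN centered at the MLE, with data `H` and `S`. -/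
def A2' {p : ℕ} {Ω : ℕ → Type} [∀ n, MeasurableSpace (Ω n)] (P : ∀ n, Measure (Ω n))
    (L : ∀ n, Ω n → EuclideanSpace ℝ (Fin p) → ℝ)
    (θhat : ∀ n, Ω n → EuclideanSpace ℝ (Fin p)) (α : ℕ → ℝ)
    (H : ∀ n, Ω n → Matrix (Fin p) (Fin p) ℝ)
    (S : ∀ n, Ω n → Fin p → Fin p → Fin p → ℝ) : Prop :=
  Tendsto (fun n => P n {ω | (H n ω).IsSymm ∧ (H n ω).PosDef}) atTop (nhds 1) ∧
  ∃ M : ℝ, ∃ δ : ℝ, 0 < δ ∧ ∀ ε : ℝ, 0 < ε → ∃ N : ℕ, ∀ n ≥ N,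
    P n {ω | ∃ h : EuclideanSpace ℝ (Fin p), ‖h‖ ≤ δ * Real.sqrt (α n * (n : ℝ)) ∧
      (M / (α n * (n : ℝ))) * ‖h‖ ^ 4 <
        α n * (Real.log (L n ω (θhat n ω + (Real.sqrt (α n * (n : ℝ)))⁻¹ • h)) -
            Real.log (L n ω (θhat n ω)))
          + (1 / 2) * ∑ i, ∑ j, h i * H n ω i j * h j
          - (6 * Real.sqrt (α n * (n : ℝ)))⁻¹ *
              ∑ i, ∑ j, ∑ k, S n ω i j k * h i * h j * h k} < ENNReal.ofReal ε

/-- Assumption (A3'): salience of the MLE. -/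
def A3' {p : ℕ} {Ω : ℕ → Type} [∀ n, MeasurableSpace (Ω n)] (P : ∀ n, Measure (Ω n))
    (L : ∀ n, Ω n → EuclideanSpace ℝ (Fin p) → ℝ)
    (θhat : ∀ n, Ω n → EuclideanSpace ℝ (Fin p)) : Prop :=
  ∀ ε : ℝ, 0 < ε → ∀ δ' : ℝ, 0 < δ' → ∃ c : ℝ, 0 < c ∧ ∃ N : ℕ, ∀ n ≥ N,
    P n {ω | ∃ θ, δ' ≤ ‖θ - θhat n ω‖ ∧
      -c < (n : ℝ)⁻¹ * (Real.log (L n ω θ) - Real.log (L n ω (θhat n ω)))}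
      < ENNReal.ofReal ε

/-- Condition (ALap) for the function `b` in the Laplace approximation. -/
def ALap {p : ℕ} {Ω : ℕ → Type} [∀ n, MeasurableSpace (Ω n)] (P : ∀ n, Measure (Ω n))
    (θhat : ∀ n, Ω n → EuclideanSpace ℝ (Fin p)) (θstar : EuclideanSpace ℝ (Fin p))
    (α : ℕ → ℝ) (b : EuclideanSpace ℝ (Fin p) → ℝ) : Prop :=
  Integrable b ∧
  (∃ δ : ℝ, 0 < δ ∧ ∃ C : ℝ, ∀ θ ∈ Metric.ball θstar δ, |b θ| ≤ C) ∧
  ∃ v : ∀ n, Ω n → EuclideanSpace ℝ (Fin p), ∃ M : ℝ, ∃ δ : ℝ, 0 < δ ∧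
    ∀ ε : ℝ, 0 < ε → ∃ N : ℕ, ∀ n ≥ N,
      P n {ω | ∃ h : EuclideanSpace ℝ (Fin p), ‖h‖ ≤ δ * Real.sqrt (α n * (n : ℝ)) ∧
        (∑ i, v n ω i * h i) / Real.sqrt (α n * (n : ℝ)) + (M / (α n * (n : ℝ))) * ‖h‖ ^ 2 <
          b (θhat n ω + (Real.sqrt (α n * (n : ℝ)))⁻¹ • h) - b (θhat n ω)}
        < ENNReal.ofReal ε

/-- The posterior mean as a vector in Euclidean space. -/
def postMean {p : ℕ} {Ω : Type} (L : Ω → EuclideanSpace ℝ (Fin p) → ℝ)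
    (prior : EuclideanSpace ℝ (Fin p) → ℝ) (α : ℝ) (ω : Ω) :
    EuclideanSpace ℝ (Fin p) :=
  (WithLp.equiv 2 (Fin p → ℝ)).symm (fun j => ∫ θ, θ j * post L prior α ω θ)

/-- A coupling of two measures. -/
def IsCoupling {X : Type} [MeasurableSpace X] (μ ν : Measure X)
    (γ : Measure (X × X)) : Prop :=
  IsProbabilityMeasure γ ∧ γ.map Prod.fst = μ ∧ γ.map Prod.snd = ν

/-- The `s`-Wasserstein distance. -/
def wassersteinDist {X : Type} [MeasurableSpace X] [PseudoMetricSpace X]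
    (s : ℝ) (μ ν : Measure X) : ℝ :=
  sInf {c : ℝ | ∃ γ : Measure (X × X), IsCoupling μ ν γ ∧
    c = (∫ x : X × X, dist x.1 x.2 ^ s ∂γ) ^ (1 / s)}

/-- The total variation distance between two measures. -/
def tvDist {X : Type} [MeasurableSpace X] (μ ν : Measure X) : ℝ :=
  sSup {x : ℝ | ∃ A : Set X, MeasurableSet A ∧ x = |(μ A).toReal - (ν A).toReal|}

/-- Standard basis vector of Euclidean space. -/
def basisE (p : ℕ) (i : Fin p) : EuclideanSpace ℝ (Fin p) :=
  EuclideanSpace.single i (1 : ℝ)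

/-- First directional partial derivative. -/
def d1 {p : ℕ} (g : EuclideanSpace ℝ (Fin p) → ℝ) (θ : EuclideanSpace ℝ (Fin p))
    (i : Fin p) : ℝ :=
  fderiv ℝ g θ (basisE p i)

/-- Second-order partial derivative. -/
def d2 {p : ℕ} (g : EuclideanSpace ℝ (Fin p) → ℝ) (θ : EuclideanSpace ℝ (Fin p))
    (i j : Fin p) : ℝ :=
  fderiv ℝ (fun θ' => d1 g θ' j) θ (basisE p i)

/-- Third-order partial derivative. -/
def d3 {p : ℕ} (g : EuclideanSpace ℝ (Fin p) → ℝ) (θ : EuclideanSpace ℝ (Fin p))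
    (i j k : Fin p) : ℝ :=
  fderiv ℝ (fun θ' => d2 g θ' j k) θ (basisE p i)

/-- Fourth-order partial derivative. -/
def d4 {p : ℕ} (g : EuclideanSpace ℝ (Fin p) → ℝ) (θ : EuclideanSpace ℝ (Fin p))
    (i j k l : Fin p) : ℝ :=
  fderiv ℝ (fun θ' => d3 g θ' j k l) θ (basisE p i)

section GaussianDensity

variable {p : ℕ}

/-- The bilinear form on Euclidean space attached to a matrix. -/
def matrixForm (V : Matrix (Fin p) (Fin p) ℝ) (x y : EuclideanSpace ℝ (Fin p)) : ℝ :=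
  ∑ i, ∑ j, x i * V i j * y j

lemma continuous_matrixForm (V : Matrix (Fin p) (Fin p) ℝ) :
    Continuous fun z : EuclideanSpace ℝ (Fin p) × EuclideanSpace ℝ (Fin p) =>
      matrixForm V z.1 z.2 := by
  unfold matrixForm
  fun_prop

lemma gaussDensity_nonneg (μ : EuclideanSpace ℝ (Fin p)) {S : Matrix (Fin p) (Fin p) ℝ}
    (hS : S.PosDef) (θ : EuclideanSpace ℝ (Fin p)) : 0 ≤ gaussDensity p μ S θ := by
  have := hS.det_pos
  unfold gaussDensity
  positivity

lemma continuous_gaussDensity (μ : EuclideanSpace ℝ (Fin p)) (S : Matrix (Fin p) (Fin p) ℝ) :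
    Continuous (gaussDensity p μ S) := by
  unfold gaussDensity
  fun_prop

lemma gaussDensity_zero_inv {V : Matrix (Fin p) (Fin p) ℝ} (hV : V.PosDef)
    (h : EuclideanSpace ℝ (Fin p)) :
    gaussDensity p 0 V⁻¹ h =
      (2 * Real.pi) ^ (-(p : ℝ) / 2) * V.det ^ ((1 : ℝ) / 2) *
        Real.exp (-(1 / 2) * matrixForm V h h) := by
  have hdet := hV.det_pos
  have hinv : V⁻¹⁻¹ = V := Matrix.nonsing_inv_nonsing_inv V (isUnit_iff_ne_zero.2 hdet.ne')
  have h1 : V⁻¹.det ^ (-(1 : ℝ) / 2) = V.det ^ ((1 : ℝ) / 2) := by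
    rw [Matrix.det_nonsing_inv, Ring.inverse_eq_inv', ← Real.rpow_neg_one, ← Real.rpow_mul hdet.le]
    norm_num
  unfold gaussDensity
  rw [hinv, h1]
  simp [matrixForm]

/-- Affine equivariance of the Gaussian density. -/
lemma gaussDensity_rescale {V : Matrix (Fin p) (Fin p) ℝ} (hV : V.PosDef) {s : ℝ} (hs : 0 < s)
    (μ θ : EuclideanSpace ℝ (Fin p)) :
    gaussDensity p μ ((s ^ 2)⁻¹ • V⁻¹) θ = s ^ p * gaussDensity p 0 V⁻¹ (s • (θ - μ)) := by
  have hdet := hV.inv.det_pos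
  have hinv : ((s ^ 2)⁻¹ • V⁻¹)⁻¹ = s ^ 2 • V⁻¹⁻¹ := by
    have : Invertible ((s ^ 2)⁻¹) := invertibleOfNonzero (by positivity)
    rw [Matrix.inv_smul _ _ (isUnit_iff_ne_zero.2 hdet.ne')]
    simp
  have h1 : ((s ^ 2)⁻¹ • V⁻¹).det ^ (-(1 : ℝ) / 2) = s ^ p * V⁻¹.det ^ (-(1 : ℝ) / 2) := by
    rw [Matrix.det_smul, Fintype.card_fin, Real.mul_rpow (by positivity) hdet.le]
    congr 1
    rw [← inv_pow, ← pow_mul, ← Real.rpow_natCast, ← Real.rpow_mul (by positivity),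
      Real.inv_rpow hs.le, ← Real.rpow_neg hs.le, ← Real.rpow_natCast]
    congr 1
    push_cast
    ring
  have h2 : ∑ i, ∑ j, (θ i - μ i) * ((s ^ 2)⁻¹ • V⁻¹)⁻¹ i j * (θ j - μ j) =
      ∑ i, ∑ j, ((s • (θ - μ)) i - (0 : EuclideanSpace ℝ (Fin p)) i) * V⁻¹⁻¹ i j *
        ((s • (θ - μ)) j - (0 : EuclideanSpace ℝ (Fin p)) j) := by
    rw [hinv]
    refine Finset.sum_congr rfl fun i _ => Finset.sum_congr rfl fun j _ => ?_
    simp only [Matrix.smul_apply, PiLp.smul_apply, PiLp.sub_apply, PiLp.zero_apply, smul_eq_mul]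
    ring
  unfold gaussDensity
  rw [h1, h2]
  ring

lemma integral_gaussDensity_zero_inv {V : Matrix (Fin p) (Fin p) ℝ} (hV : V.PosDef) :
    ∫ h, gaussDensity p 0 V⁻¹ h = 1 := by
  obtain ⟨A, hA⟩ : ∃ A : Matrix (Fin p) (Fin p) ℝ, V = A.transpose * A := by
    open scoped MatrixOrder in
    obtain ⟨A, hA⟩ := CStarAlgebra.nonneg_iff_eq_star_mul_self.1 hV.posSemidef.nonneg
    exact ⟨A, by simpa [Matrix.star_eq_conjTranspose] using hA⟩
  have hdet : V.det = A.det ^ 2 := by rw [hA, Matrix.det_mul, Matrix.det_transpose, sq]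
  have hAdet : A.det ≠ 0 := by
    intro h
    have := hV.det_pos
    simp [hdet, h] at this
  let T : EuclideanSpace ℝ (Fin p) →ₗ[ℝ] EuclideanSpace ℝ (Fin p) := Matrix.toEuclideanLin A
  have hTdet : LinearMap.det T = A.det := by
    simp [T, Matrix.toEuclideanLin_eq_toLin_orthonormal, LinearMap.det_toLin]
  have hform : ∀ h, matrixForm V h h = ‖T h‖ ^ 2 := by
    intro h
    rw [EuclideanSpace.real_norm_sq_eq]
    simp only [T, matrixForm, hA, Matrix.toLpLin_apply, Matrix.mul_apply,
      Matrix.transpose_apply, Matrix.mulVec, dotProduct, sq, Finset.mul_sum, Finset.sum_mul]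
    rw [Finset.sum_comm_cycle]
    refine Finset.sum_congr rfl fun k _ => ?_
    refine Finset.sum_congr rfl fun i _ => Finset.sum_congr rfl fun j _ => ?_
    ring
  have hmap := Measure.map_linearMap_addHaar_eq_smul_addHaar
    (volume : Measure (EuclideanSpace ℝ (Fin p))) (f := T) (by rwa [hTdet])
  have hint : ∫ h, Real.exp (-(1 / 2) * ‖T h‖ ^ 2) =
      |A.det|⁻¹ * (2 * Real.pi) ^ ((p : ℝ) / 2) := by
    have h1 : ∫ h, Real.exp (-(1 / 2) * ‖T h‖ ^ 2) =
        ∫ x, Real.exp (-(1 / 2) * ‖x‖ ^ 2) ∂(Measure.map T volume) := by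
      rw [integral_map]
      · exact (LinearMap.continuous_of_finiteDimensional T).aemeasurable
      · exact Continuous.aestronglyMeasurable (by fun_prop)
    rw [h1, hmap, integral_smul_measure,
      GaussianFourier.integral_rexp_neg_mul_sq_norm (by norm_num), hTdet,
      ENNReal.toReal_ofReal (by positivity), finrank_euclideanSpace_fin, abs_inv, smul_eq_mul]
    congr 2
    ring
  simp_rw [gaussDensity_zero_inv hV, integral_const_mul, hform, hint, hdet]
  rw [← sq_abs, ← Real.rpow_natCast, ← Real.rpow_mul (abs_nonneg _), neg_div,
    Real.rpow_neg (by positivity)]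
  have h2 : (2 * Real.pi) ^ ((p : ℝ) / 2) ≠ 0 := by positivity
  have h3 : |A.det| ≠ 0 := abs_ne_zero.2 hAdet
  norm_num
  field_simp

lemma integrable_gaussDensity_zero_inv {V : Matrix (Fin p) (Fin p) ℝ} (hV : V.PosDef) :
    Integrable (gaussDensity p 0 V⁻¹) :=
  .of_integral_ne_zero (by rw [integral_gaussDensity_zero_inv hV]; exact one_ne_zero)

end GaussianDensity

section L1Convergence

variable {X ι : Type*} [MeasurableSpace X] {μ : Measure X}

/-- **Scheffé's lemma** for nonnegative functions with a common integral. -/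
lemma tendsto_integral_abs_sub_of_integral_eq {l : Filter ι} [l.IsCountablyGenerated]
    {f : ι → X → ℝ} {g : X → ℝ} (hf : ∀ i, Integrable (f i) μ) (hg : Integrable g μ)
    (hf0 : ∀ i x, 0 ≤ f i x) (hg0 : ∀ x, 0 ≤ g x) (heq : ∀ i, ∫ x, f i x ∂μ = ∫ x, g x ∂μ)
    (hlim : ∀ x, Tendsto (fun i => f i x) l (nhds (g x))) :
    Tendsto (fun i => ∫ x, |f i x - g x| ∂μ) l (nhds 0) := by
  have hpos : Tendsto (fun i => ∫ x, max (g x - f i x) 0 ∂μ) l (nhds (∫ _, (0 : ℝ) ∂μ)) := by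
    refine tendsto_integral_filter_of_dominated_convergence g ?_ ?_ hg ?_
    · exact .of_forall fun i => ((hg.sub (hf i)).pos_part).aestronglyMeasurable
    · refine .of_forall fun i => .of_forall fun x => ?_
      rw [Real.norm_of_nonneg (le_max_right _ _)]
      exact max_le (by linarith [hf0 i x]) (hg0 x)
    · refine .of_forall fun x => ?_
      have := ((tendsto_const_nhds (x := g x)).sub (hlim x)).max (tendsto_const_nhds (x := (0 : ℝ)))
      simpa using this
  have hsplit : ∀ i, ∫ x, |f i x - g x| ∂μ = 2 * ∫ x, max (g x - f i x) 0 ∂μ := by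
    intro i
    have h1 : ∀ x, |f i x - g x| = 2 * max (g x - f i x) 0 + (f i x - g x) := by
      intro x
      rcases le_total (f i x) (g x) with h | h
      · rw [abs_of_nonpos (by linarith), max_eq_left (by linarith)]; ring
      · rw [abs_of_nonneg (by linarith), max_eq_right (by linarith)]; ring
    have hmax : Integrable (fun x => 2 * max (g x - f i x) 0) μ :=
      (hg.sub (hf i)).pos_part.const_mul 2
    have hsub : Integrable (fun x => f i x - g x) μ := (hf i).sub hg
    simp_rw [h1]
    rw [integral_add hmax hsub, integral_const_mul,
      integral_sub (hf i) hg, heq i]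
    ring
  simp_rw [hsplit]
  simpa using hpos.const_mul 2

/-- Normalizing two densities at most doubles their relative `L¹` distance. -/
lemma integral_abs_normalized_sub_le {f g : X → ℝ} (hf : Integrable f μ) (hg : Integrable g μ)
    (hf0 : ∀ x, 0 ≤ f x) (hfpos : 0 < ∫ x, f x ∂μ) (hgpos : 0 < ∫ x, g x ∂μ) :
    ∫ x, |f x / (∫ y, f y ∂μ) - g x / (∫ y, g y ∂μ)| ∂μ ≤
      2 / (∫ y, g y ∂μ) * ∫ x, |f x - g x| ∂μ := by
  have hfg : Integrable (fun x => |f x - g x|) μ := (hf.sub hg).abs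
  set F := ∫ y, f y ∂μ
  set G := ∫ y, g y ∂μ
  have hdiff : |F - G| ≤ ∫ x, |f x - g x| ∂μ := by
    rw [← integral_sub hf hg]
    exact abs_integral_le_integral_abs
  calc ∫ x, |f x / F - g x / G| ∂μ
      ≤ ∫ x, (|f x - g x| / G + f x * (|F - G| / (F * G))) ∂μ := by
        refine integral_mono ((hf.div_const F).sub (hg.div_const G)).abs
          ((hfg.div_const G).add (hf.mul_const _)) fun x => ?_
        have h1 : f x / F - g x / G = (f x - g x) / G + f x * ((G - F) / (F * G)) := by
          field_simp
          ring
        have h2 : |f x * ((G - F) / (F * G))| = f x * (|F - G| / (F * G)) := by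
          rw [abs_mul, abs_of_nonneg (hf0 x), abs_div, abs_of_pos (mul_pos hfpos hgpos),
            abs_sub_comm]
        have h3 : |(f x - g x) / G| = |f x - g x| / G := by rw [abs_div, abs_of_pos hgpos]
        simp only
        rw [h1, ← h2, ← h3]
        exact abs_add_le _ _
    _ = (∫ x, |f x - g x| ∂μ) / G + |F - G| / G := by
        rw [integral_add (hfg.div_const G) (hf.mul_const _), integral_div,
          integral_mul_const]
        congr 1
        change F * _ = _
        field_simp
    _ ≤ 2 / G * ∫ x, |f x - g x| ∂μ := by
        rw [← add_div, div_mul_eq_mul_div]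
        gcongr
        linarith

/-- Changing the exponent of a bounded function from `1` to `t` costs at most a weight `w`. -/
lemma rpow_le_two_mul_add_inv {g w t : ℝ} (hg : 0 < g) (hg2 : g ≤ 2) (hw : 1 ≤ w)
    (ht : 1 / 2 ≤ t) (ht2 : t ≤ 2) : g ^ t ≤ 2 * (g * w) + w⁻¹ := by
  have hw0 : 0 < w := by linarith
  rcases le_total 1 t with h1 | h1
  · have h2 : g ^ (t - 1) ≤ 2 :=
      calc g ^ (t - 1) ≤ 2 ^ (t - 1) := Real.rpow_le_rpow hg.le hg2 (by linarith)
        _ ≤ 2 ^ (1 : ℝ) := Real.rpow_le_rpow_of_exponent_le (by norm_num) (by linarith)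
        _ = 2 := by norm_num
    have h3 : g ^ t = g * g ^ (t - 1) := by
      rw [Real.rpow_sub_one hg.ne']
      field_simp
    have h4 : g * g ^ (t - 1) ≤ g * 2 := by gcongr
    have h5 : g * 2 ≤ 2 * (g * w) := by nlinarith
    have h6 : 0 < w⁻¹ := by positivity
    linarith
  · rcases le_total (w⁻¹ ^ 2) g with h2 | h2
    · have h3 : g ^ t = g * g⁻¹ ^ (1 - t) := by
        rw [Real.inv_rpow hg.le, ← Real.rpow_neg hg.le, neg_sub, Real.rpow_sub_one hg.ne']
        field_simp
      have h4 : g⁻¹ ^ (1 - t) ≤ w :=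
        calc g⁻¹ ^ (1 - t) ≤ (w ^ 2) ^ (1 - t) := by
              refine Real.rpow_le_rpow (by positivity) ?_ (by linarith)
              rw [inv_le_comm₀ hg (by positivity), ← inv_pow]
              exact h2
          _ ≤ (w ^ 2) ^ (1 / 2 : ℝ) :=
              Real.rpow_le_rpow_of_exponent_le (one_le_pow₀ hw) (by linarith)
          _ = w := by rw [← Real.sqrt_eq_rpow, Real.sqrt_sq hw0.le]
      have h5 : g * g⁻¹ ^ (1 - t) ≤ g * w := by gcongr
      have h6 : 0 < w⁻¹ := by positivity
      have h7 : 0 < g * w := by positivity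
      linarith
    · have h3 : g ^ t ≤ w⁻¹ :=
        calc g ^ t ≤ (w⁻¹ ^ 2) ^ t := Real.rpow_le_rpow hg.le h2 (by linarith)
          _ ≤ (w⁻¹ ^ 2) ^ (1 / 2 : ℝ) :=
              Real.rpow_le_rpow_of_exponent_ge (by positivity)
                (pow_le_one₀ (by positivity) (inv_le_one_of_one_le₀ hw)) ht
          _ = w⁻¹ := by rw [← Real.sqrt_eq_rpow, Real.sqrt_sq (by positivity)]
      have h7 : 0 < g * w := by positivity
      linarith

/-- If the mass outside the sets `S k` is uniformly small as `k → ∞` and `f i → g` in `L¹` on each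
`S k`, then `f i → g` in `L¹`. -/
lemma tendsto_integral_abs_sub_of_tight {l : Filter ι}
    {f : ι → X → ℝ} {g : X → ℝ} {S : ℕ → Set X} {b : ℕ → ℝ}
    (hf : ∀ᶠ i in l, Integrable (f i) μ) (hg : Integrable g μ)
    (hS : ∀ k, MeasurableSet (S k))
    (hnear : ∀ k, Tendsto (fun i => ∫ x in S k, |f i x - g x| ∂μ) l (nhds 0))
    (hfar : ∀ᶠ k in atTop, ∀ᶠ i in l, ∫ x in (S k)ᶜ, |f i x - g x| ∂μ ≤ b k)
    (hb : Tendsto b atTop (nhds 0)) :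
    Tendsto (fun i => ∫ x, |f i x - g x| ∂μ) l (nhds 0) := by
  rw [Metric.tendsto_nhds]
  intro ε hε
  obtain ⟨k, hk, hbk⟩ := (hfar.and (hb.eventually_lt_const (half_pos hε))).exists
  filter_upwards [hf, hk, (hnear k).eventually_lt_const (half_pos hε)] with i h1 h2 h3
  have h4 : Integrable (fun x => |f i x - g x|) μ := (h1.sub hg).abs
  rw [Real.dist_0_eq_abs, abs_of_nonneg (integral_nonneg fun x => abs_nonneg _),
    ← integral_add_compl (hS k) h4]
  linarith

end L1Convergence

section TemperedDensity

variable {p : ℕ} {ι : Type*}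

lemma integrable_inv_one_add_norm_pow :
    Integrable fun h : EuclideanSpace ℝ (Fin p) => ((1 + ‖h‖) ^ (p + 1))⁻¹ := by
  have h1 := integrable_one_add_norm (E := EuclideanSpace ℝ (Fin p)) (μ := volume)
    (r := ((p + 1 : ℕ) : ℝ)) (by simp)
  refine h1.congr (.of_forall fun h => ?_)
  simp only
  rw [Real.rpow_neg (by positivity), Real.rpow_natCast]

/-- A density bounded by `B` whose moment of order `m ≥ 1` is controlled by its mass has bounded
mass. -/
lemma integral_le_of_moment_le {f : EuclideanSpace ℝ (Fin p) → ℝ} {B M : ℝ} {m : ℕ} (hm : 1 ≤ m)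
    (hf0 : ∀ h, 0 ≤ f h) (hfB : ∀ h, f h ≤ B) (hf : Integrable f)
    (hfm : Integrable fun h => ‖h‖ ^ m * f h)
    (hmom : ∫ h, ‖h‖ ^ m * f h ≤ M * ∫ h, f h) :
    ∫ h, f h ≤ 2 * B *
      (volume (Metric.closedBall (0 : EuclideanSpace ℝ (Fin p)) (1 + 2 * |M|))).toReal := by
  set R := 1 + 2 * |M|
  have hR1 : 1 ≤ R := by have := abs_nonneg M; simp only [R]; linarith
  have hRm : 2 * |M| ≤ R ^ m := by
    calc 2 * |M| ≤ R := by simp only [R]; linarith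
      _ ≤ R ^ m := le_self_pow₀ hR1 (by omega)
  set K := Metric.closedBall (0 : EuclideanSpace ℝ (Fin p)) R
  have hKm : MeasurableSet K := measurableSet_closedBall
  have hKfin : volume K ≠ ⊤ := measure_closedBall_lt_top.ne
  have hnear : ∫ h in K, f h ≤ B * (volume K).toReal := by
    calc ∫ h in K, f h ≤ ∫ _ in K, B :=
          integral_mono hf.integrableOn (integrableOn_const hKfin) hfB
      _ = B * (volume K).toReal := by simp [Measure.real, mul_comm]
  have hfar : R ^ m * ∫ h in Kᶜ, f h ≤ |M| * ∫ h, f h := by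
    calc R ^ m * ∫ h in Kᶜ, f h = ∫ h in Kᶜ, R ^ m * f h := (integral_const_mul _ _).symm
      _ ≤ ∫ h in Kᶜ, ‖h‖ ^ m * f h := by
          refine setIntegral_mono_on (hf.const_mul _).integrableOn hfm.integrableOn hKm.compl ?_
          intro h hh
          have : R < ‖h‖ := by simpa [K] using hh
          have h0 := hf0 h
          gcongr
      _ ≤ ∫ h, ‖h‖ ^ m * f h :=
          setIntegral_le_integral hfm (.of_forall fun h => mul_nonneg (by positivity) (hf0 h))
      _ ≤ M * ∫ h, f h := hmom
      _ ≤ |M| * ∫ h, f h :=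
          mul_le_mul_of_nonneg_right (le_abs_self M) (integral_nonneg hf0)
  have hsplit := integral_add_compl hKm hf
  have hfar0 : 0 ≤ ∫ h in Kᶜ, f h := integral_nonneg hf0
  have hfar' : 2 * ∫ h in Kᶜ, f h ≤ ∫ h, f h := by
    by_cases hM : |M| = 0
    · have h1 : R ^ m * ∫ h in Kᶜ, f h ≤ 0 := by simpa [hM] using hfar
      have h2 : 1 * ∫ h in Kᶜ, f h ≤ R ^ m * ∫ h in Kᶜ, f h := by
        gcongr
        exact one_le_pow₀ hR1
      have h3 : 0 ≤ ∫ h, f h := integral_nonneg hf0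
      linarith
    · have hMpos : 0 < |M| := lt_of_le_of_ne (abs_nonneg M) (Ne.symm hM)
      have h1 : (2 * |M|) * ∫ h in Kᶜ, f h ≤ R ^ m * ∫ h in Kᶜ, f h := by gcongr
      refine le_of_mul_le_mul_left ?_ hMpos
      linarith
  linarith

/-- Convergence in `L¹` of tempered unnormalized densities `g ^ t * w` to a limit, from pointwise
convergence and a moment bound at temperature `1`. -/
lemma tendsto_integral_abs_tempered_sub {l : Filter ι} [l.IsCountablyGenerated]
    {g w : ι → EuclideanSpace ℝ (Fin p) → ℝ} {t : ι → ℝ} {q : EuclideanSpace ℝ (Fin p) → ℝ}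
    {κ c M : ℝ}
    (hg0 : ∀ i h, 0 < g i h) (hw0 : ∀ i h, 0 ≤ w i h) (hwκ : ∀ i h, w i h ≤ κ)
    (hq : Integrable q) (hq0 : ∀ h, 0 < q h) (hc : 0 ≤ c)
    (hg2 : ∀ᶠ i in l, ∀ h, g i h ≤ 2)
    (hglim : ∀ h, Tendsto (fun i => g i h) l (nhds (q h)))
    (hwlim : ∀ h, Tendsto (fun i => w i h) l (nhds c))
    (ht : Tendsto t l (nhds 1))
    (hint : ∀ᶠ i in l, Integrable fun h => g i h ^ t i * w i h)
    (hmom : ∀ᶠ i in l, Integrable (fun h => g i h * w i h) ∧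
      Integrable (fun h => ‖h‖ ^ (p + 2) * (g i h * w i h)) ∧
      ∫ h, ‖h‖ ^ (p + 2) * (g i h * w i h) ≤ M * ∫ h, g i h * w i h) :
    Tendsto (fun i => ∫ h, |g i h ^ t i * w i h - c * q h|) l (nhds 0) := by
  have ht12 : ∀ᶠ i in l, 1 / 2 ≤ t i ∧ t i ≤ 2 :=
    (ht.eventually_const_le (by norm_num)).and (ht.eventually_le_const (by norm_num))
  set C : ℝ := 2 * (2 * κ) *
    (volume (Metric.closedBall (0 : EuclideanSpace ℝ (Fin p)) (1 + 2 * |M|))).toReal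
  set e : EuclideanSpace ℝ (Fin p) → ℝ := fun h => κ * ((1 + ‖h‖) ^ (p + 1))⁻¹ + c * q h
  have he : Integrable e := (integrable_inv_one_add_norm_pow.const_mul κ).add (hq.const_mul c)
  let S : ℕ → Set (EuclideanSpace ℝ (Fin p)) := fun k => Metric.closedBall 0 k
  have hSm : ∀ k, MeasurableSet (S k) := fun k => measurableSet_closedBall
  refine tendsto_integral_abs_sub_of_tight (S := S)
    (b := fun k => 2 ^ (p + 2) * (|M| * C) * (k : ℝ)⁻¹ + ∫ h in (S k)ᶜ, e h)
    hint (hq.const_mul c) hSm ?_ ?_ ?_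
  · intro k
    have hfin : IsFiniteMeasure (volume.restrict (S k)) :=
      ⟨by simpa using (measure_closedBall_lt_top (x := (0 : EuclideanSpace ℝ (Fin p))))⟩
    have : Tendsto (fun i => ∫ h in S k, |g i h ^ t i * w i h - c * q h|) l
        (nhds (∫ h in S k, (0 : ℝ))) := by
      refine tendsto_integral_filter_of_dominated_convergence (fun h => 5 * κ + c * q h) ?_ ?_ ?_ ?_
      · filter_upwards [hint] with i hi
        exact (hi.sub (hq.const_mul c)).abs.aestronglyMeasurable.restrict
      · filter_upwards [hg2, ht12] with i hi hti
        refine .of_forall fun h => ?_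
        have h1 : g i h ^ t i ≤ 5 := by
          have h1 := rpow_le_two_mul_add_inv (hg0 i h) (hi h) le_rfl hti.1 hti.2
          have h2 := hi h
          norm_num at h1
          linarith
        have h3 : 0 < g i h ^ t i := Real.rpow_pos_of_pos (hg0 i h) _
        have h4 : g i h ^ t i * w i h ≤ 5 * κ :=
          mul_le_mul h1 (hwκ i h) (hw0 i h) (by norm_num)
        have h5 : 0 ≤ g i h ^ t i * w i h := mul_nonneg h3.le (hw0 i h)
        have h6 : 0 ≤ c * q h := mul_nonneg hc (hq0 h).le
        rw [Real.norm_of_nonneg (abs_nonneg _), abs_le]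
        constructor <;> linarith
      · exact (integrable_const _).add (hq.const_mul c).restrict
      · refine .of_forall fun h => ?_
        have h1 : Tendsto (fun i => g i h ^ t i * w i h - c * q h) l (nhds 0) := by
          have h2 := (((hglim h).rpow ht (.inl (hq0 h).ne')).mul (hwlim h)).sub_const (c * q h)
          rw [Real.rpow_one] at h2
          convert h2 using 2
          ring
        simpa using h1.abs
    simpa using this
  · filter_upwards [eventually_ge_atTop 1] with k hk
    filter_upwards [hg2, ht12, hint, hmom] with i hi hti hinti hmomi
    obtain ⟨hgw, hgwm, hle⟩ := hmomi
    have hk1 : (1 : ℝ) ≤ k := by exact_mod_cast hk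
    have hκ : 0 ≤ κ := (hw0 i 0).trans (hwκ i 0)
    have hgw0 : ∀ h, 0 ≤ g i h * w i h := fun h => mul_nonneg (hg0 i h).le (hw0 i h)
    have hmass : ∫ h, g i h * w i h ≤ C :=
      integral_le_of_moment_le (by omega) hgw0
        (fun h => mul_le_mul (hi h) (hwκ i h) (hw0 i h) (by norm_num)) hgw hgwm hle
    have hmom' : ∫ h, ‖h‖ ^ (p + 2) * (g i h * w i h) ≤ |M| * C := by
      calc _ ≤ M * ∫ h, g i h * w i h := hle
        _ ≤ |M| * ∫ h, g i h * w i h :=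
          mul_le_mul_of_nonneg_right (le_abs_self M) (integral_nonneg hgw0)
        _ ≤ |M| * C := by gcongr
    have hpt : ∀ h ∈ (S k)ᶜ, |g i h ^ t i * w i h - c * q h| ≤
        2 ^ (p + 2) * (k : ℝ)⁻¹ * (‖h‖ ^ (p + 2) * (g i h * w i h)) + e h := by
      intro h hh
      have hkh : (k : ℝ) < ‖h‖ := by simpa [S] using hh
      have hW1 : 1 ≤ (1 + ‖h‖) ^ (p + 1) := one_le_pow₀ (by linarith [norm_nonneg h])
      have hW : (1 + ‖h‖) ^ (p + 1) ≤ 2 ^ (p + 1) * ((k : ℝ)⁻¹ * ‖h‖ ^ (p + 2)) := by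
        calc (1 + ‖h‖) ^ (p + 1) ≤ (2 * ‖h‖) ^ (p + 1) := by gcongr; linarith
          _ = 2 ^ (p + 1) * (1 * ‖h‖ ^ (p + 1)) := by ring
          _ ≤ 2 ^ (p + 1) * (((k : ℝ)⁻¹ * ‖h‖) * ‖h‖ ^ (p + 1)) := by
            gcongr
            rw [inv_mul_eq_div, one_le_div (by linarith)]
            exact hkh.le
          _ = _ := by ring
      have h1 := rpow_le_two_mul_add_inv (hg0 i h) (hi h) hW1 hti.1 hti.2
      have h2 : g i h ^ t i * w i h ≤
          2 * ((g i h * w i h) * (1 + ‖h‖) ^ (p + 1)) + κ * ((1 + ‖h‖) ^ (p + 1))⁻¹ := by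
        calc g i h ^ t i * w i h
            ≤ (2 * (g i h * (1 + ‖h‖) ^ (p + 1)) + ((1 + ‖h‖) ^ (p + 1))⁻¹) * w i h :=
              mul_le_mul_of_nonneg_right h1 (hw0 i h)
          _ = 2 * ((g i h * w i h) * (1 + ‖h‖) ^ (p + 1)) +
              w i h * ((1 + ‖h‖) ^ (p + 1))⁻¹ := by ring
          _ ≤ _ := by gcongr; exact hwκ i h
      have h3 : (g i h * w i h) * (1 + ‖h‖) ^ (p + 1) ≤
          (g i h * w i h) * (2 ^ (p + 1) * ((k : ℝ)⁻¹ * ‖h‖ ^ (p + 2))) :=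
        mul_le_mul_of_nonneg_left hW (hgw0 h)
      have h5 : 0 ≤ g i h ^ t i * w i h :=
        mul_nonneg (Real.rpow_pos_of_pos (hg0 i h) _).le (hw0 i h)
      have h6 : 0 ≤ c * q h := mul_nonneg hc (hq0 h).le
      have h7 : 2 * ((g i h * w i h) * (2 ^ (p + 1) * ((k : ℝ)⁻¹ * ‖h‖ ^ (p + 2)))) =
          2 ^ (p + 2) * (k : ℝ)⁻¹ * (‖h‖ ^ (p + 2) * (g i h * w i h)) := by ring
      calc |g i h ^ t i * w i h - c * q h| ≤ g i h ^ t i * w i h + c * q h := by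
            rw [abs_le]; constructor <;> linarith
        _ ≤ _ := by simp only [e]; linarith
    calc ∫ h in (S k)ᶜ, |g i h ^ t i * w i h - c * q h|
        ≤ ∫ h in (S k)ᶜ,
            (2 ^ (p + 2) * (k : ℝ)⁻¹ * (‖h‖ ^ (p + 2) * (g i h * w i h)) + e h) :=
          setIntegral_mono_on (hinti.sub (hq.const_mul c)).abs.integrableOn
            ((hgwm.const_mul _).add he).integrableOn (hSm k).compl hpt
      _ = 2 ^ (p + 2) * (k : ℝ)⁻¹ * (∫ h in (S k)ᶜ, ‖h‖ ^ (p + 2) * (g i h * w i h)) +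
            ∫ h in (S k)ᶜ, e h := by
          rw [integral_add (hgwm.const_mul _).integrableOn he.integrableOn, integral_const_mul]
      _ ≤ 2 ^ (p + 2) * (k : ℝ)⁻¹ * (|M| * C) + ∫ h in (S k)ᶜ, e h := by
          gcongr
          refine (setIntegral_le_integral hgwm (.of_forall fun h => ?_)).trans hmom'
          exact mul_nonneg (by positivity) (hgw0 h)
      _ = _ := by ring
  · have h1 : Tendsto (fun k : ℕ => ∫ h in (S k)ᶜ, e h) atTop (nhds 0) := by
      have hanti : Antitone fun k => (S k)ᶜ := fun a b hab =>
        Set.compl_subset_compl.2 (Metric.closedBall_subset_closedBall (by exact_mod_cast hab))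
      have h2 := tendsto_setIntegral_of_antitone (μ := volume) (f := e) (fun k => (hSm k).compl)
        hanti ⟨0, he.integrableOn⟩
      have h3 : ⋂ k, (S k)ᶜ = ∅ := by
        rw [Set.iInter_eq_empty_iff]
        intro h
        obtain ⟨k, hk⟩ := exists_nat_ge ‖h‖
        exact ⟨k, by simpa [S] using hk⟩
      simpa [h3] using h2
    have h2 := (tendsto_inv_atTop_nhds_zero_nat (𝕜 := ℝ)).const_mul (2 ^ (p + 2) * (|M| * C))
    simpa using h2.add h1

end TemperedDensity

section ConvergenceInProbability

variable {Ω : ℕ → Type} [∀ n, MeasurableSpace (Ω n)]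

/-- The filter of events whose complements have probability tending to zero. -/
def inProbFilter (P : ∀ n, Measure (Ω n)) : Filter (Σ n, Ω n) where
  sets := {S | Tendsto (fun n => P n {ω | (⟨n, ω⟩ : Σ n, Ω n) ∉ S}) atTop (nhds 0)}
  univ_sets := by simp
  sets_of_superset {S T} hS hST := by
    refine tendsto_of_tendsto_of_tendsto_of_le_of_le tendsto_const_nhds hS
      (fun _ => zero_le) fun n => measure_mono fun ω hω => ?_
    exact fun h => hω (hST h)
  inter_sets {S T} hS hT := by
    have hsum := Tendsto.add hS hT
    rw [add_zero] at hsum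
    refine tendsto_of_tendsto_of_tendsto_of_le_of_le tendsto_const_nhds hsum
      (fun _ => zero_le) fun n => ?_
    refine (measure_mono fun ω hω => ?_).trans (measure_union_le _ _)
    by_cases h : (⟨n, ω⟩ : Σ n, Ω n) ∈ S
    · exact Or.inr fun h' => hω ⟨h, h'⟩
    · exact Or.inl h

variable {P : ∀ n, Measure (Ω n)}

lemma eventually_inProbFilter {Q : (Σ n, Ω n) → Prop} :
    (∀ᶠ x in inProbFilter P, Q x) ↔
      Tendsto (fun n => P n {ω | ¬ Q ⟨n, ω⟩}) atTop (nhds 0) :=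
  Iff.rfl

lemma tendstoInProb_iff {E : Type*} [NormedAddCommGroup E] {Y : ∀ n, Ω n → E} {y : E} :
    TendstoInProb P Y y ↔ Tendsto (fun x : Σ n, Ω n => Y x.1 x.2) (inProbFilter P) (nhds y) := by
  rw [(Metric.nhds_basis_closedBall (x := y)).tendsto_right_iff]
  simp only [TendstoInProb, eventually_inProbFilter, mem_closedBall_iff_norm, not_le]

lemma tendsto_fst_inProbFilter : Tendsto Sigma.fst (inProbFilter P) atTop := by
  refine tendsto_atTop.2 fun N => eventually_inProbFilter.2 ?_
  refine tendsto_const_nhds.congr' ?_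
  filter_upwards [eventually_ge_atTop N] with n hn
  simp [hn]

/-- To prove convergence in probability it suffices to prove it on a tight family of events. -/
lemma tendsto_inProbFilter_of_tight {Y : Type*} [TopologicalSpace Y] {X : (Σ n, Ω n) → Y} {y : Y}
    {T : ℝ → Set (Σ n, Ω n)}
    (hX : ∀ M, Tendsto X (inProbFilter P ⊓ 𝓟 (T M)) (nhds y))
    (hT : ∀ ε : ℝ, 0 < ε → ∃ M, ∀ᶠ n in atTop,
      P n {ω | (⟨n, ω⟩ : Σ n, Ω n) ∉ T M} ≤ ENNReal.ofReal ε) :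
    Tendsto X (inProbFilter P) (nhds y) := by
  intro U hU
  refine ENNReal.tendsto_nhds_zero.2 fun ε hε => ?_
  obtain ⟨δ, hδ, hδε⟩ := ENNReal.lt_iff_exists_nnreal_btwn.1 (ENNReal.half_pos hε.ne')
  obtain ⟨M, hM⟩ := hT δ (by exact_mod_cast hδ)
  have h1 : ∀ᶠ x in inProbFilter P, x ∈ T M → X x ∈ U := eventually_inf_principal.1 (hX M hU)
  have h2 := ENNReal.tendsto_nhds_zero.1 (eventually_inProbFilter.1 h1) _
    (ENNReal.half_pos hε.ne')
  filter_upwards [hM, h2] with n h3 h4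
  calc P n {ω | (⟨n, ω⟩ : Σ n, Ω n) ∉ X ⁻¹' U}
      ≤ P n ({ω | (⟨n, ω⟩ : Σ n, Ω n) ∉ T M} ∪
          {ω | ¬ ((⟨n, ω⟩ : Σ n, Ω n) ∈ T M → X ⟨n, ω⟩ ∈ U)}) := by
        refine measure_mono fun ω hω => ?_
        by_cases h : (⟨n, ω⟩ : Σ n, Ω n) ∈ T M
        · exact Or.inr fun h' => hω (h' h)
        · exact Or.inl h
    _ ≤ ε / 2 + ε / 2 := by
        refine (measure_union_le _ _).trans (add_le_add (h3.trans ?_) h4)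
        rw [ENNReal.ofReal_coe_nnreal]
        exact hδε.le
    _ = ε := ENNReal.add_halves ε

/-- An asymptotically normal estimator multiplied by a vanishing factor vanishes in probability. -/
lemma tendstoInProb_rescaled_estimator {p : ℕ} [∀ n, IsProbabilityMeasure (P n)]
    {θhat : ∀ n, Ω n → EuclideanSpace ℝ (Fin p)} {θstar : EuclideanSpace ℝ (Fin p)} {α : ℕ → ℝ}
    (hθ : ∀ n, Measurable (θhat n)) (hA0 : A0 P θhat θstar) (hαpos : ∀ n, 0 < α n)
    (hα0 : Tendsto α atTop (nhds 0)) :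
    TendstoInProb P (fun n ω => Real.sqrt (α n * n) • (θhat n ω - θstar)) 0 := by
  obtain ⟨-, S, -, -, hweak⟩ := hA0
  set G := gaussDensity p 0 S
  have hGint : Integrable G := by
    have h1 := hweak (fun _ => 1) continuous_const ⟨1, by simp⟩
    simp only [integral_const, probReal_univ, smul_eq_mul, one_mul] at h1
    refine .of_integral_ne_zero (μ := volume) ?_
    rw [← tendsto_nhds_unique tendsto_const_nhds h1]
    exact one_ne_zero
  let f : ℕ → EuclideanSpace ℝ (Fin p) → ℝ := fun k x => max 0 (min 1 (‖x‖ - k))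
  have hf0 : ∀ k x, 0 ≤ f k x := fun k x => le_max_left _ _
  have hf1 : ∀ k x, f k x ≤ 1 := fun k x => max_le zero_le_one (min_le_left _ _)
  have hfc : ∀ k, Continuous (f k) := fun k => by fun_prop
  have hftail : Tendsto (fun k => ∫ x, f k x * G x) atTop (nhds 0) := by
    have : Tendsto (fun k => ∫ x, f k x * G x) atTop
        (nhds (∫ _ : EuclideanSpace ℝ (Fin p), (0 : ℝ))) := by
      refine tendsto_integral_of_dominated_convergence (fun x => |G x|) ?_ hGint.abs ?_ ?_
      · exact fun k => (hfc k).aestronglyMeasurable.mul hGint.aestronglyMeasurable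
      · refine fun k => .of_forall fun x => ?_
        rw [norm_mul, Real.norm_of_nonneg (hf0 k x), Real.norm_eq_abs]
        exact mul_le_of_le_one_left (abs_nonneg _) (hf1 k x)
      · refine .of_forall fun x => tendsto_const_nhds.congr' ?_
        obtain ⟨N, hN⟩ := exists_nat_ge ‖x‖
        filter_upwards [eventually_ge_atTop N] with k hk
        have hk' : ‖x‖ - k ≤ 0 := by
          have : (N : ℝ) ≤ k := by exact_mod_cast hk
          linarith
        have : f k x = 0 := max_eq_left ((min_le_right _ _).trans hk')
        rw [this, zero_mul]
    simpa using this
  intro ε hε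
  refine ENNReal.tendsto_nhds_zero.2 fun η hη => ?_
  obtain ⟨δ, hδ, hδη⟩ := ENNReal.lt_iff_exists_nnreal_btwn.1 hη
  have hδ' : (0 : ℝ) < δ := by exact_mod_cast hδ
  obtain ⟨k, hk⟩ := (hftail.eventually_lt_const hδ').exists
  have hev := (hweak (f k) (hfc k) ⟨1, fun x => by
    rw [abs_of_nonneg (hf0 k x)]; exact hf1 k x⟩).eventually_lt_const hk
  have hsqrt : Tendsto (fun n => Real.sqrt (α n) * (k + 1)) atTop (nhds 0) := by
    simpa using (hα0.sqrt).mul_const ((k : ℝ) + 1)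
  filter_upwards [hev, hsqrt.eventually_lt_const hε] with n h1 h2
  refine le_trans ?_ hδη.le
  let D : Ω n → EuclideanSpace ℝ (Fin p) := fun ω => Real.sqrt n • (θhat n ω - θstar)
  have hD : Measurable D := by
    have := hθ n
    fun_prop
  have hsub : {ω | ε < ‖Real.sqrt (α n * n) • (θhat n ω - θstar) - 0‖} ⊆ {ω | 1 ≤ f k (D ω)} := by
    intro ω hω
    have h3 : Real.sqrt (α n * n) • (θhat n ω - θstar) = Real.sqrt (α n) • D ω := by
      rw [Real.sqrt_mul (hαpos n).le, mul_smul]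
    rw [Set.mem_ofPred_eq, sub_zero, h3, norm_smul, Real.norm_of_nonneg (Real.sqrt_nonneg _)] at hω
    have h4 : (k : ℝ) + 1 ≤ ‖D ω‖ := le_of_mul_le_mul_left (h2.trans hω).le
      (Real.sqrt_pos.2 (hαpos n))
    have h5 : (1 : ℝ) ≤ ‖D ω‖ - k := by linarith
    exact le_max_of_le_right (le_min le_rfl h5)
  have hint : Integrable (fun ω => f k (D ω)) (P n) :=
    .of_bound ((hfc k).measurable.comp hD).aestronglyMeasurable 1 (.of_forall fun ω => by
      rw [Real.norm_of_nonneg (hf0 k _)]; exact hf1 k _)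
  have hmarkov := mul_meas_ge_le_integral_of_nonneg (.of_forall fun ω => hf0 k (D ω)) hint 1
  rw [one_mul] at hmarkov
  refine (measure_mono hsub).trans ?_
  rw [← ENNReal.ofReal_coe_nnreal, ENNReal.le_ofReal_iff_toReal_le (measure_ne_top _ _) hδ'.le]
  exact hmarkov.trans h1.le

end ConvergenceInProbability

section RescaledPosterior

variable {p : ℕ}

lemma integral_eq_integral_rescaled {s : ℝ} (hs : 0 < s) (θ₀ : EuclideanSpace ℝ (Fin p))
    (f : EuclideanSpace ℝ (Fin p) → ℝ) :
    ∫ θ, f θ = (s ^ p)⁻¹ * ∫ h, f (θ₀ + s⁻¹ • h) := by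
  rw [Measure.integral_comp_inv_smul_of_nonneg volume (fun h => f (θ₀ + h)) hs.le,
    finrank_euclideanSpace_fin, integral_add_left_eq_self, smul_eq_mul,
    inv_mul_cancel_left₀ (by positivity)]

lemma integrable_rescaled_iff {s : ℝ} (hs : 0 < s) (θ₀ : EuclideanSpace ℝ (Fin p))
    (f : EuclideanSpace ℝ (Fin p) → ℝ) :
    Integrable (fun h => f (θ₀ + s⁻¹ • h)) ↔ Integrable f := by
  rw [integrable_comp_smul_iff volume (fun h => f (θ₀ + h)) (by positivity)]
  exact (measurePreserving_add_left volume θ₀).integrable_comp_emb (measurableEmbedding_addLeft θ₀)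

lemma rescaled_tempered_likelihood {a b : ℝ} (ha : 0 < a) {x y : ℝ} (hx : 0 < x) (hy : 0 < y)
    (z : ℝ) : ((x / y) ^ a) ^ (b / a) * z = (y ^ b)⁻¹ * (x ^ b * z) := by
  rw [← Real.rpow_mul (by positivity), mul_div_cancel₀ _ ha.ne', Real.div_rpow hx.le hy.le]
  ring

/-- The distance between posterior and Gaussian is invariant under the local rescaling
`θ = θ₀ + h / s`. -/
lemma integral_abs_post_sub_gaussDensity_eq {ι : Type}
    {ℓ : ι → EuclideanSpace ℝ (Fin p) → ℝ} {prior : EuclideanSpace ℝ (Fin p) → ℝ}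
    {V : Matrix (Fin p) (Fin p) ℝ} (hV : V.PosDef) {a b s : ℝ} (ha : 0 < a) (hs : 0 < s)
    (hℓ : ∀ i θ, 0 < ℓ i θ) (θ₀ μ : EuclideanSpace ℝ (Fin p)) (i : ι) :
    ∫ θ, |post ℓ prior b i θ - gaussDensity p μ ((s ^ 2)⁻¹ • V⁻¹) θ| =
      ∫ h, |((ℓ i (θ₀ + s⁻¹ • h) / ℓ i θ₀) ^ a) ^ (b / a) * prior (θ₀ + s⁻¹ • h) /
          (∫ h', ((ℓ i (θ₀ + s⁻¹ • h') / ℓ i θ₀) ^ a) ^ (b / a) * prior (θ₀ + s⁻¹ • h')) -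
        gaussDensity p 0 V⁻¹ (h - s • (μ - θ₀))| := by
  simp_rw [rescaled_tempered_likelihood ha (hℓ i _) (hℓ i θ₀), integral_const_mul]
  rw [integral_eq_integral_rescaled hs θ₀, ← integral_const_mul]
  congr 1
  ext h
  have hsp : 0 < s ^ p := by positivity
  have hy : 0 < ℓ i θ₀ ^ b := Real.rpow_pos_of_pos (hℓ i θ₀) b
  rw [← abs_of_pos (inv_pos.2 hsp), ← abs_mul]
  congr 1
  have harg : s • (θ₀ + s⁻¹ • h - μ) = h - s • (μ - θ₀) := by
    rw [smul_sub, smul_add, smul_inv_smul₀ hs.ne', smul_sub]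
    abel
  rw [gaussDensity_rescale hV hs, harg, post,
    integral_eq_integral_rescaled hs θ₀ (fun θ => ℓ i θ ^ b * prior θ)]
  rw [mul_sub, inv_mul_cancel_left₀ hsp.ne', mul_div_mul_left _ _ (inv_ne_zero hy.ne')]
  congr 1
  generalize (∫ h, ℓ i (θ₀ + s⁻¹ • h) ^ b * prior (θ₀ + s⁻¹ • h)) = I
  rcases eq_or_ne I 0 with hI | hI
  · simp [hI]
  · field_simp

/-- Polynomial decay of the tempered likelihood yields integrability of posterior moments. -/
lemma integrable_moment_of_salience {ℓ prior : EuclideanSpace ℝ (Fin p) → ℝ}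
    {θ₀ : EuclideanSpace ℝ (Fin p)} {γ : ℝ → ℝ} {a N c₀ c₁ c₂ r : ℝ} {k : ℕ}
    (hℓ : ∀ θ, 0 < ℓ θ) (hprior : Integrable prior)
    (hprior0 : ∀ θ, 0 ≤ prior θ)
    (ha : 0 ≤ a) (hN : 0 ≤ N) (hc₁ : 0 < c₁) (hr : 0 < r)
    (hγ : ∀ v, r ≤ v → c₀ * Real.log (1 + c₁ * v) - c₂ ≤ γ v)
    (hsal : ∀ θ, r ≤ ‖θ - θ₀‖ → Real.log (ℓ θ) - Real.log (ℓ θ₀) ≤ -(N * γ ‖θ - θ₀‖))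
    (hk : (k : ℝ) ≤ a * N * c₀) (hint : Integrable fun θ => ℓ θ ^ a * prior θ) :
    Integrable fun θ => ‖θ - θ₀‖ ^ k * (ℓ θ ^ a * prior θ) := by
  set C := Real.exp (a * Real.log (ℓ θ₀) + a * N * c₂)
  refine ((hint.const_mul (r ^ k)).add (hprior.const_mul (C / c₁ ^ k))).mono' ?_ ?_
  · exact (Continuous.aestronglyMeasurable (by fun_prop)).mul hint.aestronglyMeasurable
  refine .of_forall fun θ => ?_
  have hℓa : 0 < ℓ θ ^ a := Real.rpow_pos_of_pos (hℓ θ) a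
  have hp := hprior0 θ
  have hC : 0 < C := Real.exp_pos _
  rw [Real.norm_of_nonneg (by positivity)]
  simp only [Pi.add_apply]
  rcases le_total ‖θ - θ₀‖ r with h | h
  · have h1 : ‖θ - θ₀‖ ^ k * (ℓ θ ^ a * prior θ) ≤ r ^ k * (ℓ θ ^ a * prior θ) := by gcongr
    have h2 : 0 ≤ C / c₁ ^ k * prior θ := by positivity
    linarith
  · set v := ‖θ - θ₀‖
    have hv : 0 < v := hr.trans_le h
    have h1v : 1 < 1 + c₁ * v := by nlinarith
    have hlog : 0 ≤ Real.log (1 + c₁ * v) := Real.log_nonneg h1v.le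
    have hbound : ℓ θ ^ a ≤ C * ((1 + c₁ * v) ^ k)⁻¹ := by
      have h1 : ((1 + c₁ * v) ^ k)⁻¹ = Real.exp (-(k * Real.log (1 + c₁ * v))) := by
        rw [Real.exp_neg, ← Real.log_pow, Real.exp_log (by positivity)]
      rw [h1, ← Real.exp_add, Real.rpow_def_of_pos (hℓ θ), Real.exp_le_exp]
      have h2 : N * (c₀ * Real.log (1 + c₁ * v) - c₂) ≤ N * γ v := by gcongr; exact hγ v h
      have h3 : a * (Real.log (ℓ θ) - Real.log (ℓ θ₀)) ≤
          a * -(N * (c₀ * Real.log (1 + c₁ * v) - c₂)) := by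
        gcongr
        linarith [hsal θ h]
      have h4 : k * Real.log (1 + c₁ * v) ≤ a * N * c₀ * Real.log (1 + c₁ * v) := by gcongr
      linarith
    have h5 : v ^ k * ℓ θ ^ a ≤ C / c₁ ^ k := by
      rw [le_div_iff₀ (by positivity)]
      calc v ^ k * ℓ θ ^ a * c₁ ^ k = (c₁ * v) ^ k * ℓ θ ^ a := by ring
        _ ≤ (1 + c₁ * v) ^ k * (C * ((1 + c₁ * v) ^ k)⁻¹) := by gcongr; linarith
        _ = C := by field_simp
    have h6 : v ^ k * ℓ θ ^ a * prior θ ≤ C / c₁ ^ k * prior θ := by gcongr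
    have h7 : 0 ≤ r ^ k * (ℓ θ ^ a * prior θ) := by positivity
    linarith

end RescaledPosterior

section BernsteinVonMises

variable {p : ℕ} {ι : Type}

/-- Local asymptotic normality makes rescaled tempered likelihood ratios converge pointwise. -/
lemma tendsto_exp_of_lan {l : Filter ι} {V : Matrix (Fin p) (Fin p) ℝ}
    {u : ι → EuclideanSpace ℝ (Fin p) → ℝ} {d : ι → EuclideanSpace ℝ (Fin p)}
    (hd : Tendsto d l (nhds 0))
    (hlan : ∀ j : ℕ, ∀ᶠ i in l, ∀ h, ‖h‖ ≤ j + 1 →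
      |u i h - matrixForm V h (d i) + (1 / 2) * matrixForm V h h| ≤ 1 / ((j : ℝ) + 1))
    (h : EuclideanSpace ℝ (Fin p)) :
    Tendsto (fun i => Real.exp (u i h)) l (nhds (Real.exp (-(1 / 2) * matrixForm V h h))) := by
  refine (Real.continuous_exp.tendsto _).comp ?_
  have hcross : Tendsto (fun i => matrixForm V h (d i)) l (nhds 0) := by
    have h1 : Continuous fun y => matrixForm V h y :=
      (continuous_matrixForm V).comp (by fun_prop : Continuous fun y => (h, y))
    have h2 := (h1.tendsto 0).comp hd
    simpa [matrixForm, Function.comp_def] using h2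
  have hrem : Tendsto (fun i => u i h - matrixForm V h (d i) + (1 / 2) * matrixForm V h h) l
      (nhds 0) := by
    rw [Metric.tendsto_nhds]
    intro ε hε
    obtain ⟨j₁, hj₁⟩ := exists_nat_one_div_lt hε
    obtain ⟨j₂, hj₂⟩ := exists_nat_ge ‖h‖
    filter_upwards [hlan (max j₁ j₂)] with i hi
    rw [Real.dist_0_eq_abs]
    have hmax : (j₂ : ℝ) ≤ ((max j₁ j₂ : ℕ) : ℝ) := by exact_mod_cast le_max_right _ _
    have hmax' : (j₁ : ℝ) ≤ ((max j₁ j₂ : ℕ) : ℝ) := by exact_mod_cast le_max_left _ _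
    refine ((hi h (by linarith)).trans ?_).trans_lt hj₁
    gcongr
  have h3 := (hrem.add hcross).sub_const ((1 / 2) * matrixForm V h h)
  convert h3 using 2 <;> ring

/-- Under local asymptotic normality the maximal likelihood ratio is asymptotically trivial. -/
lemma eventually_exp_le_two_of_lan {l : Filter ι} {V : Matrix (Fin p) (Fin p) ℝ}
    {u : ι → EuclideanSpace ℝ (Fin p) → ℝ} {d : ι → EuclideanSpace ℝ (Fin p)}
    (hd : Tendsto d l (nhds 0)) (hmax : ∀ᶠ i in l, ∀ h, u i h ≤ u i (d i))
    (hlan : ∀ j : ℕ, ∀ᶠ i in l, ∀ h, ‖h‖ ≤ j + 1 →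
      |u i h - matrixForm V h (d i) + (1 / 2) * matrixForm V h h| ≤ 1 / ((j : ℝ) + 1)) :
    ∀ᶠ i in l, ∀ h, Real.exp (u i h) ≤ 2 := by
  have hform : Tendsto (fun i => matrixForm V (d i) (d i)) l (nhds 0) := by
    have h2 := ((continuous_matrixForm V).tendsto (0, 0)).comp (hd.prodMk_nhds hd)
    simpa [matrixForm, Function.comp_def] using h2
  have hnorm : ∀ᶠ i in l, ‖d i‖ ≤ 1 := by
    have h2 : Tendsto (fun i => ‖d i‖) l (nhds 0) := by simpa using hd.norm
    exact h2.eventually_le_const one_pos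
  filter_upwards [hmax, hlan 1, hnorm, hform.eventually_le_const (show (0 : ℝ) < 1 / 10 by norm_num)]
    with i h1 h2 h3 h4 h
  have h5 := (abs_le.1 (h2 (d i) (by norm_num; linarith))).2
  norm_num at h5
  have h6 : u i h ≤ 0.6 := by linarith [h1 h]
  have h7 : (0.6 : ℝ) ≤ Real.log 2 := by linarith [Real.log_two_gt_d9]
  calc Real.exp (u i h) ≤ Real.exp (Real.log 2) := Real.exp_le_exp.2 (h6.trans h7)
    _ = 2 := Real.exp_log two_pos

/-- If unnormalized densities converge in `L¹` to a multiple of a Gaussian density, then the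
normalized densities approach Gaussian densities with asymptotically vanishing means. -/
lemma tendsto_integral_abs_normalized_sub_gaussDensity {l : Filter ι} [l.IsCountablyGenerated]
    {V : Matrix (Fin p) (Fin p) ℝ} (hV : V.PosDef)
    {f : ι → EuclideanSpace ℝ (Fin p) → ℝ} {d : ι → EuclideanSpace ℝ (Fin p)} {c : ℝ} (hc : 0 < c)
    (hd : Tendsto d l (nhds 0))
    (hf : ∀ᶠ i in l, Integrable (f i) ∧ (∀ h, 0 ≤ f i h) ∧ 0 < ∫ h, f i h)
    (hlim : Tendsto (fun i => ∫ h, |f i h - c * gaussDensity p 0 V⁻¹ h|) l (nhds 0)) :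
    Tendsto (fun i => ∫ h, |f i h / (∫ h', f i h') - gaussDensity p 0 V⁻¹ (h - d i)|) l
      (nhds 0) := by
  set G := gaussDensity p 0 V⁻¹
  have hG : Integrable G := integrable_gaussDensity_zero_inv hV
  have hG0 : ∀ h, 0 ≤ G h := gaussDensity_nonneg 0 hV.inv
  have hG1 : ∫ h, G h = 1 := integral_gaussDensity_zero_inv hV
  have hcG : ∫ h, c * G h = c := by rw [integral_const_mul, hG1, mul_one]
  have hGd : ∀ i, Integrable fun h => G (h - d i) := fun i => hG.comp_sub_right (d i)
  have hshift : Tendsto (fun i => ∫ h, |G (h - d i) - G h|) l (nhds 0) := by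
    refine tendsto_integral_abs_sub_of_integral_eq hGd hG (fun i h => hG0 _) hG0
      (fun i => integral_sub_right_eq_self G (d i)) fun h => ?_
    have h1 : Tendsto (fun i => h - d i) l (nhds h) := by
      simpa using hd.const_sub h
    exact ((continuous_gaussDensity 0 V⁻¹).tendsto h).comp h1
  have hsum := (hlim.const_mul (2 / c)).add hshift
  rw [mul_zero, add_zero] at hsum
  refine tendsto_of_tendsto_of_tendsto_of_le_of_le' tendsto_const_nhds hsum
    (.of_forall fun i => integral_nonneg fun h => abs_nonneg _) ?_
  filter_upwards [hf] with i ⟨hfi, hf0, hfpos⟩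
  have hnorm := integral_abs_normalized_sub_le hfi (hG.const_mul c) hf0 hfpos
    (by rw [hcG]; exact hc)
  simp only [hcG, mul_div_cancel_left₀ _ hc.ne'] at hnorm
  have h1 : Integrable fun h => |f i h / (∫ h', f i h') - G h| :=
    ((hfi.div_const _).sub hG).abs
  have h2 : Integrable fun h => |G (h - d i) - G h| := ((hGd i).sub hG).abs
  calc ∫ h, |f i h / (∫ h', f i h') - G (h - d i)|
      ≤ ∫ h, (|f i h / (∫ h', f i h') - G h| + |G (h - d i) - G h|) := by
        refine integral_mono ((hfi.div_const _).sub (hGd i)).abs (h1.add h2) fun h => ?_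
        simp only
        rw [abs_sub_comm (G (h - d i))]
        exact abs_sub_le _ _ _
    _ = (∫ h, |f i h / (∫ h', f i h') - G h|) + ∫ h, |G (h - d i) - G h| := integral_add h1 h2
    _ ≤ _ := by gcongr

/-- Transfer of a posterior moment bound to the local parameter `h = s • (θ - θ₀)`. -/
lemma rescaled_moment_le {ℓ : ι → EuclideanSpace ℝ (Fin p) → ℝ}
    {prior : EuclideanSpace ℝ (Fin p) → ℝ} {θ₀ : EuclideanSpace ℝ (Fin p)} {a s M : ℝ} {i : ι}
    {k : ℕ} (hℓ : ∀ θ, 0 < ℓ i θ) (hs : 0 < s)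
    (hZ : Integrable (fun θ => ℓ i θ ^ a * prior θ) ∧ 0 < ∫ θ, ℓ i θ ^ a * prior θ)
    (hint : Integrable fun θ => ‖s • (θ - θ₀)‖ ^ k * (ℓ i θ ^ a * prior θ))
    (hM : ∫ θ, ‖s • (θ - θ₀)‖ ^ k * post ℓ prior a i θ ≤ M) :
    Integrable (fun h => (ℓ i (θ₀ + s⁻¹ • h) / ℓ i θ₀) ^ a * prior (θ₀ + s⁻¹ • h)) ∧
      Integrable (fun h => ‖h‖ ^ k *
        ((ℓ i (θ₀ + s⁻¹ • h) / ℓ i θ₀) ^ a * prior (θ₀ + s⁻¹ • h))) ∧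
      ∫ h, ‖h‖ ^ k * ((ℓ i (θ₀ + s⁻¹ • h) / ℓ i θ₀) ^ a * prior (θ₀ + s⁻¹ • h)) ≤
        M * ∫ h, (ℓ i (θ₀ + s⁻¹ • h) / ℓ i θ₀) ^ a * prior (θ₀ + s⁻¹ • h) := by
  obtain ⟨hZ1, hZ2⟩ := hZ
  have hy : 0 < ℓ i θ₀ ^ a := Real.rpow_pos_of_pos (hℓ θ₀) a
  have hsp : 0 < s ^ p := by positivity
  have h1 : ∀ h, (ℓ i (θ₀ + s⁻¹ • h) / ℓ i θ₀) ^ a * prior (θ₀ + s⁻¹ • h) =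
      (ℓ i θ₀ ^ a)⁻¹ * (ℓ i (θ₀ + s⁻¹ • h) ^ a * prior (θ₀ + s⁻¹ • h)) := fun h => by
    rw [Real.div_rpow (hℓ _).le (hℓ _).le]
    ring
  have h2 : ∀ h, ‖h‖ ^ k * ((ℓ i θ₀ ^ a)⁻¹ * (ℓ i (θ₀ + s⁻¹ • h) ^ a * prior (θ₀ + s⁻¹ • h))) =
      (ℓ i θ₀ ^ a)⁻¹ * (‖s • (θ₀ + s⁻¹ • h - θ₀)‖ ^ k *
        (ℓ i (θ₀ + s⁻¹ • h) ^ a * prior (θ₀ + s⁻¹ • h))) := fun h => by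
    rw [add_sub_cancel_left, smul_inv_smul₀ hs.ne']
    ring
  have h3 := integral_eq_integral_rescaled hs θ₀ fun θ => ℓ i θ ^ a * prior θ
  have h4 := integral_eq_integral_rescaled hs θ₀ fun θ =>
    ‖s • (θ - θ₀)‖ ^ k * (ℓ i θ ^ a * prior θ)
  simp only [h1, h2, integral_const_mul]
  refine ⟨((integrable_rescaled_iff hs θ₀ _).2 hZ1).const_mul _,
    ((integrable_rescaled_iff hs θ₀ _).2 hint).const_mul _, ?_⟩
  have h5 : ∫ θ, ‖s • (θ - θ₀)‖ ^ k * post ℓ prior a i θ =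
      (∫ θ, ‖s • (θ - θ₀)‖ ^ k * (ℓ i θ ^ a * prior θ)) / ∫ θ, ℓ i θ ^ a * prior θ := by
    rw [← integral_div]
    congr 1
    ext θ
    exact mul_div_assoc' _ _ _
  rw [h5, div_le_iff₀ hZ2, h3, h4, mul_left_comm] at hM
  have h6 := le_of_mul_le_mul_left hM (inv_pos.2 hsp)
  rw [mul_left_comm]
  gcongr

/-- Deterministic Bernstein–von Mises theorem for perturbed tempering, along a filter. -/
theorem tendsto_integral_abs_post_sub_gaussDensity {l : Filter ι}
    {V : Matrix (Fin p) (Fin p) ℝ} (hV : V.PosDef)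
    {ℓ : ι → EuclideanSpace ℝ (Fin p) → ℝ} {prior : EuclideanSpace ℝ (Fin p) → ℝ}
    {θhat : ι → EuclideanSpace ℝ (Fin p)} {θ₀ : EuclideanSpace ℝ (Fin p)}
    {a b s : ι → ℝ} {κ M : ℝ}
    (hℓ : ∀ i θ, 0 < ℓ i θ) (hmax : ∀ i θ, ℓ i θ ≤ ℓ i (θhat i))
    (hprior0 : ∀ θ, 0 ≤ prior θ) (hpriorκ : ∀ θ, prior θ ≤ κ)
    (hpriorc : ContinuousAt prior θ₀) (hpriorpos : 0 < prior θ₀)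
    (ha : ∀ i, 0 < a i)
    (hZa : ∀ i, Integrable (fun θ => ℓ i θ ^ a i * prior θ) ∧ 0 < ∫ θ, ℓ i θ ^ a i * prior θ)
    (hZb : ∀ i, Integrable (fun θ => ℓ i θ ^ b i * prior θ) ∧ 0 < ∫ θ, ℓ i θ ^ b i * prior θ)
    (hs : Tendsto s l atTop) (hd : Tendsto (fun i => s i • (θhat i - θ₀)) l (nhds 0))
    (hba : Tendsto (fun i => b i / a i) l (nhds 1))
    (hlan : ∀ j : ℕ, ∀ᶠ i in l, ∀ h, ‖h‖ ≤ j + 1 →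
      |a i * (Real.log (ℓ i (θ₀ + (s i)⁻¹ • h)) - Real.log (ℓ i θ₀)) -
          matrixForm V h (s i • (θhat i - θ₀)) + (1 / 2) * matrixForm V h h| ≤ 1 / ((j : ℝ) + 1))
    (hmom : ∀ᶠ i in l,
      Integrable (fun θ => ‖s i • (θ - θ₀)‖ ^ (p + 2) * (ℓ i θ ^ a i * prior θ)) ∧
      ∫ θ, ‖s i • (θ - θ₀)‖ ^ (p + 2) * post ℓ prior (a i) i θ ≤ M) :
    Tendsto (fun i => ∫ θ, |post ℓ prior (b i) i θ -
      gaussDensity p (θhat i) ((s i ^ 2)⁻¹ • V⁻¹) θ|) l (nhds 0) := by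
  wlog hl : l.IsCountablyGenerated generalizing l
  · let U : ℕ → Set ι := fun j => {i | ∀ h, ‖h‖ ≤ j + 1 →
      |a i * (Real.log (ℓ i (θ₀ + (s i)⁻¹ • h)) - Real.log (ℓ i θ₀)) -
        matrixForm V h (s i • (θhat i - θ₀)) + (1 / 2) * matrixForm V h h| ≤ 1 / ((j : ℝ) + 1)}
    let W : Set ι := {i |
      Integrable (fun θ => ‖s i • (θ - θ₀)‖ ^ (p + 2) * (ℓ i θ ^ a i * prior θ)) ∧
      ∫ θ, ‖s i • (θ - θ₀)‖ ^ (p + 2) * post ℓ prior (a i) i θ ≤ M}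
    let l' := comap s atTop ⊓ (comap (fun i => s i • (θhat i - θ₀)) (nhds 0) ⊓
      (comap (fun i => b i / a i) (nhds 1) ⊓ ((⨅ j, 𝓟 (U j)) ⊓ 𝓟 W)))
    have hle : l ≤ l' := le_inf hs.le_comap <| le_inf hd.le_comap <| le_inf hba.le_comap <|
      le_inf (le_iInf fun j => le_principal_iff.2 (hlan j)) (le_principal_iff.2 hmom)
    have h1 : l' ≤ comap s atTop := inf_le_left
    have h2 : l' ≤ comap (fun i => s i • (θhat i - θ₀)) (nhds 0) :=
      inf_le_right.trans inf_le_left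
    have h3 : l' ≤ comap (fun i => b i / a i) (nhds 1) :=
      inf_le_right.trans (inf_le_right.trans inf_le_left)
    have h4 : l' ≤ ⨅ j, 𝓟 (U j) :=
      inf_le_right.trans (inf_le_right.trans (inf_le_right.trans inf_le_left))
    have h5 : l' ≤ 𝓟 W :=
      inf_le_right.trans (inf_le_right.trans (inf_le_right.trans inf_le_right))
    exact (this (l := l') (tendsto_comap.mono_left h1) (tendsto_comap.mono_left h2)
      (tendsto_comap.mono_left h3) (fun j => le_principal_iff.1 (h4.trans (iInf_le _ j)))
      (le_principal_iff.1 h5) inferInstance).mono_left hle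
  set d : ι → EuclideanSpace ℝ (Fin p) := fun i => s i • (θhat i - θ₀)
  set g : ι → EuclideanSpace ℝ (Fin p) → ℝ :=
    fun i h => (ℓ i (θ₀ + (s i)⁻¹ • h) / ℓ i θ₀) ^ a i with hg
  set w : ι → EuclideanSpace ℝ (Fin p) → ℝ := fun i h => prior (θ₀ + (s i)⁻¹ • h) with hw
  have hspos : ∀ᶠ i in l, 0 < s i := hs.eventually_gt_atTop 0
  have hexp : ∀ i h, g i h =
      Real.exp (a i * (Real.log (ℓ i (θ₀ + (s i)⁻¹ • h)) - Real.log (ℓ i θ₀))) := fun i h => by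
    simp only [hg]
    rw [Real.rpow_def_of_pos (div_pos (hℓ i _) (hℓ i _)),
      Real.log_div (hℓ i _).ne' (hℓ i _).ne', mul_comm]
  have hg0 : ∀ i h, 0 < g i h := fun i h => by rw [hexp]; exact Real.exp_pos _
  have hg2 : ∀ᶠ i in l, ∀ h, g i h ≤ 2 := by
    simp only [hexp]
    refine eventually_exp_le_two_of_lan hd ?_ hlan
    filter_upwards [hspos] with i hi h
    have h1 : θ₀ + (s i)⁻¹ • d i = θhat i := by
      simp only [d]
      rw [inv_smul_smul₀ hi.ne', add_sub_cancel]
    rw [h1]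
    have h2 := Real.log_le_log (hℓ i _) (hmax i (θ₀ + (s i)⁻¹ • h))
    have h3 := (ha i).le
    gcongr
  have hglim : ∀ h, Tendsto (fun i => g i h) l
      (nhds (Real.exp (-(1 / 2) * matrixForm V h h))) := by
    simp only [hexp]
    exact tendsto_exp_of_lan hd hlan
  have hwlim : ∀ h, Tendsto (fun i => w i h) l (nhds (prior θ₀)) := fun h => by
    have h1 : Tendsto (fun i => θ₀ + (s i)⁻¹ • h) l (nhds θ₀) := by
      simpa using (hs.inv_tendsto_atTop.smul_const h).const_add θ₀
    exact hpriorc.tendsto.comp h1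
  set K : ℝ := (2 * Real.pi) ^ (-(p : ℝ) / 2) * V.det ^ ((1 : ℝ) / 2) with hK
  have hKpos : 0 < K := by
    have := hV.det_pos
    positivity
  have hq : ∀ h, Real.exp (-(1 / 2) * matrixForm V h h) = K⁻¹ * gaussDensity p 0 V⁻¹ h :=
    fun h => by rw [gaussDensity_zero_inv hV, ← hK, inv_mul_cancel_left₀ hKpos.ne']
  have hqint : Integrable fun h => Real.exp (-(1 / 2) * matrixForm V h h) := by
    simp only [hq]
    exact (integrable_gaussDensity_zero_inv hV).const_mul _
  have hF : ∀ᶠ i in l, Integrable (fun h => g i h ^ (b i / a i) * w i h) ∧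
      (∀ h, 0 ≤ g i h ^ (b i / a i) * w i h) ∧ 0 < ∫ h, g i h ^ (b i / a i) * w i h := by
    filter_upwards [hspos] with i hi
    have h1 : 0 < ℓ i θ₀ ^ b i := Real.rpow_pos_of_pos (hℓ i θ₀) _
    have h2 := integral_eq_integral_rescaled hi θ₀ fun θ => ℓ i θ ^ b i * prior θ
    have h3 := (hZb i).2
    refine ⟨?_, fun h => mul_nonneg (Real.rpow_pos_of_pos (hg0 i h) _).le (hprior0 _), ?_⟩
    · simp only [hg, hw, rescaled_tempered_likelihood (ha i) (hℓ i _) (hℓ i θ₀)]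
      exact ((integrable_rescaled_iff hi θ₀ _).2 (hZb i).1).const_mul _
    · simp only [hg, hw, rescaled_tempered_likelihood (ha i) (hℓ i _) (hℓ i θ₀),
        integral_const_mul]
      rw [h2] at h3
      exact mul_pos (inv_pos.2 h1) (pos_of_mul_pos_right h3 (by positivity))
  have hL1 : Tendsto (fun i => ∫ h, |g i h ^ (b i / a i) * w i h -
      prior θ₀ * Real.exp (-(1 / 2) * matrixForm V h h)|) l (nhds 0) := by
    refine tendsto_integral_abs_tempered_sub (M := M) hg0 (fun i h => hprior0 _)
      (fun i h => hpriorκ _) hqint (fun h => Real.exp_pos _) hpriorpos.le hg2 hglim hwlim hba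
      (hF.mono fun i hi => hi.1) ?_
    filter_upwards [hspos, hmom] with i hi hmi
    exact rescaled_moment_le (hℓ i) hi (hZa i) hmi.1 hmi.2
  simp only [hq, ← mul_assoc] at hL1
  refine (tendsto_integral_abs_normalized_sub_gaussDensity hV (mul_pos hpriorpos (inv_pos.2 hKpos))
    hd hF hL1).congr' ?_
  filter_upwards [hspos] with i hi
  exact (integral_abs_post_sub_gaussDensity_eq hV (ha i) hi hℓ θ₀ (θhat i) i).symm

end BernsteinVonMises

section Model

variable {p : ℕ} {Ω : ℕ → Type} [∀ n, MeasurableSpace (Ω n)] {P : ∀ n, Measure (Ω n)}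

/-- A measurable property implied by events of probability tending to one holds eventually. -/
lemma eventually_inProbFilter_of_tendsto_one [∀ n, IsProbabilityMeasure (P n)]
    {Q : (Σ n, Ω n) → Prop} {S : ∀ n, Set (Ω n)} (hQ : ∀ n, MeasurableSet {ω | Q ⟨n, ω⟩})
    (hS : Tendsto (fun n => P n (S n)) atTop (nhds 1))
    (hSQ : ∀ᶠ n in atTop, ∀ ω ∈ S n, Q ⟨n, ω⟩) : ∀ᶠ x in inProbFilter P, Q x := by
  have h1 : Tendsto (fun n => P n {ω | Q ⟨n, ω⟩}) atTop (nhds 1) :=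
    tendsto_of_tendsto_of_tendsto_of_le_of_le' hS tendsto_const_nhds
      (hSQ.mono fun n hn => measure_mono hn) (.of_forall fun n => prob_le_one)
  have h2 := ENNReal.Tendsto.sub (tendsto_const_nhds (x := (1 : ENNReal))) h1
    (.inl ENNReal.one_ne_top)
  rw [tsub_self] at h2
  refine eventually_inProbFilter.2 (h2.congr fun n => ?_)
  rw [← prob_compl_eq_one_sub (hQ n)]
  rfl

/-- Under salience of `θstar`, all posterior moments are eventually finite. -/
lemma eventually_integrable_moment [∀ n, IsProbabilityMeasure (P n)]
    {L : ∀ n, Ω n → EuclideanSpace ℝ (Fin p) → ℝ} {prior : EuclideanSpace ℝ (Fin p) → ℝ}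
    {θhat : ∀ n, Ω n → EuclideanSpace ℝ (Fin p)} {θstar : EuclideanSpace ℝ (Fin p)} {α : ℕ → ℝ}
    (hLmeas : ∀ n, Measurable (Function.uncurry (L n))) (hLpos : ∀ n ω θ, 0 < L n ω θ)
    (hpriormeas : Measurable prior) (hpriornn : ∀ θ, 0 ≤ prior θ) (hprior : Integrable prior)
    (hZ : ∀ n ω, Integrable (fun θ => L n ω θ ^ (α n) * prior θ))
    (hαpos : ∀ n, 0 < α n) (hαn : Tendsto (fun n => α n * (n : ℝ)) atTop atTop)
    (hConds : Conds12 P L θhat θstar) (k : ℕ) :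
    ∀ᶠ x in inProbFilter P, Integrable fun θ =>
      ‖θ - θstar‖ ^ k * (L x.1 x.2 θ ^ α x.1 * prior θ) := by
  obtain ⟨Lc, c₀, c₁, c₂, r, γ, hLc, hc₀, hc₁, -, hr, -, hγ, hsal, -⟩ := hConds
  have hr0 : 0 < r := (div_pos (Real.exp_pos _) hc₁).trans hr
  refine eventually_inProbFilter_of_tendsto_one (fun n => ?_) hsal ?_
  · refine measurableSet_integrable
      (f := fun ω θ => ‖θ - θstar‖ ^ k * (L n ω θ ^ α n * prior θ)) ?_
    have h1 := hLmeas n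
    refine Measurable.stronglyMeasurable ?_
    simp only [Function.uncurry_def] at h1 ⊢
    fun_prop
  · filter_upwards [hαn.eventually_ge_atTop (k / (Lc * c₀))] with n hn ω hω
    refine integrable_moment_of_salience (hLpos n ω) hprior hpriornn (hαpos n).le
      (by positivity) hc₁ hr0 hγ hω ?_ (hZ n ω)
    rw [div_le_iff₀ (by positivity)] at hn
    linarith

end Model

/-- **Corollary 1** (Bernstein–von Mises in total variation for data-dependent tempering). -/
theorem bernstein_von_mises_data_dependent_tempering
    {p : ℕ} {Ω : ℕ → Type} [∀ n, MeasurableSpace (Ω n)]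
    (P : ∀ n, Measure (Ω n)) [∀ n, IsProbabilityMeasure (P n)]
    (L : ∀ n, Ω n → EuclideanSpace ℝ (Fin p) → ℝ)
    (prior : EuclideanSpace ℝ (Fin p) → ℝ)
    (θhat : ∀ n, Ω n → EuclideanSpace ℝ (Fin p))
    (θstar : EuclideanSpace ℝ (Fin p))
    (V : Matrix (Fin p) (Fin p) ℝ)
    (α : ℕ → ℝ) (αhat : ∀ n, Ω n → ℝ) (κ : ℝ)
    -- basic regularity of the model
    (hLmeas : ∀ n, Measurable (Function.uncurry (L n)))
    (hLpos : ∀ n ω θ, 0 < L n ω θ)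
    (hpriormeas : Measurable prior)
    (hpriornn : ∀ θ, 0 ≤ prior θ)
    (hpriorint : ∫ θ, prior θ = 1)
    (hθmeas : ∀ n, Measurable (θhat n))
    (hMLE : ∀ n ω θ, θ ≠ θhat n ω → L n ω θ < L n ω (θhat n ω))
    (hZ : ∀ n ω, Integrable (fun θ => L n ω θ ^ (α n) * prior θ) ∧
        0 < ∫ θ, L n ω θ ^ (α n) * prior θ)
    (hZhat : ∀ n ω, Integrable (fun θ => L n ω θ ^ (αhat n ω) * prior θ) ∧
        0 < ∫ θ, L n ω θ ^ (αhat n ω) * prior θ)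
    -- tempering sequence: `α n → 0` and `n * α n → ∞`
    (hαpos : ∀ n, 0 < α n)
    (hα0 : Tendsto α atTop (nhds 0))
    (hαn : Tendsto (fun n => α n * (n : ℝ)) atTop atTop)
    -- data-dependent tempering
    (hαhatmeas : ∀ n, Measurable (αhat n))
    (hαhatpos : ∀ n ω, 0 < αhat n ω)
    (hratio : TendstoInProb P (fun n ω => αhat n ω / α n) (1 : ℝ))
    -- assumptions
    (hA0 : A0 P θhat θstar)
    (hA1 : A1 prior θstar)
    (hA2 : A2 P L θhat θstar α V)
    (hA3 : A3 P L prior θstar α)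
    (hConds : Conds12 P L θhat θstar)
    (hκ : 0 < κ) (hpriorbd : ∀ θ, prior θ ≤ κ) :
    TendstoInProb P (fun n ω =>
      (1 / 2) * ∫ θ, |post (L n) prior (αhat n ω) ω θ -
        gaussDensity p (θhat n ω) ((α n * (n : ℝ))⁻¹ • V⁻¹) θ|) (0 : ℝ) := by
  obtain ⟨-, hVpos, hlan⟩ := hA2
  obtain ⟨δ, hδ, hpriorc, hpriorpos⟩ := hA1
  have hprior : Integrable prior :=
    .of_integral_ne_zero (by rw [hpriorint]; exact one_ne_zero)
  have hs : Tendsto (fun x : Σ n, Ω n => Real.sqrt (α x.1 * x.1)) (inProbFilter P) atTop :=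
    (Real.tendsto_sqrt_atTop.comp hαn).comp tendsto_fst_inProbFilter
  have hint := eventually_integrable_moment hLmeas hLpos hpriormeas hpriornn hprior
    (fun n ω => (hZ n ω).1) hαpos hαn hConds (p + 2)
  have hd := tendstoInProb_iff.1 (tendstoInProb_rescaled_estimator hθmeas hA0 hαpos hα0)
  rw [tendstoInProb_iff]
  refine tendsto_inProbFilter_of_tight (T := fun M => {x | ∫ θ,
    ‖Real.sqrt (α x.1 * x.1) • (θ - θstar)‖ ^ (p + 2) *
      post (L x.1) prior (α x.1) x.2 θ ≤ M}) (fun M => ?_) fun ε hε => ?_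
  · have hmain := tendsto_integral_abs_post_sub_gaussDensity (M := M) (κ := κ)
      (l := inProbFilter P ⊓ 𝓟 {x | ∫ θ, ‖Real.sqrt (α x.1 * x.1) • (θ - θstar)‖ ^ (p + 2) *
        post (L x.1) prior (α x.1) x.2 θ ≤ M})
      (ℓ := fun x => L x.1 x.2) (θhat := fun x => θhat x.1 x.2) (θ₀ := θstar) (prior := prior)
      (a := fun x => α x.1) (b := fun x => αhat x.1 x.2) (s := fun x => Real.sqrt (α x.1 * x.1))
      hVpos (fun x => hLpos x.1 x.2)
      (fun x θ => (eq_or_ne θ (θhat x.1 x.2)).elim (fun h => h ▸ le_rfl)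
        fun h => (hMLE x.1 x.2 θ h).le)
      hpriornn hpriorbd (hpriorc.continuousAt (Metric.ball_mem_nhds _ hδ))
      (hpriorpos _ (Metric.mem_ball_self hδ)) (fun x => hαpos x.1) (fun x => hZ x.1 x.2)
      (fun x => hZhat x.1 x.2) (hs.mono_left inf_le_left) (hd.mono_left inf_le_left)
      ((tendstoInProb_iff.1 hratio).mono_left inf_le_left) (fun j => ?_) ?_
    · have h1 := hmain.const_mul (1 / 2)
      rw [mul_zero] at h1
      refine h1.congr fun x => ?_
      rw [Real.sq_sqrt (mul_nonneg (hαpos _).le (Nat.cast_nonneg _))]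
      rfl
    · have h1 := (eventually_inProbFilter (P := P) (Q := fun x => ∀ h : EuclideanSpace ℝ (Fin p), ‖h‖ ≤ j + 1 →
          |α x.1 * (Real.log (L x.1 x.2 (θstar + (Real.sqrt (α x.1 * x.1))⁻¹ • h)) -
              Real.log (L x.1 x.2 θstar)) - Real.sqrt (α x.1) *
                ∑ i, ∑ j, h i * V i j * (Real.sqrt x.1 * (θhat x.1 x.2 j - θstar j))
            + (1 / 2) * ∑ i, ∑ j, h i * V i j * h j| ≤ 1 / ((j : ℝ) + 1))).2 (by
          simpa only [not_forall, not_le, exists_prop] using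
            hlan (j + 1) (by positivity) (1 / ((j : ℝ) + 1)) (by positivity))
      filter_upwards [h1.filter_mono inf_le_left] with x hx h hh
      convert hx h hh using 5
      · rw [matrixForm, Finset.mul_sum]
        refine Finset.sum_congr rfl fun i _ => ?_
        rw [Finset.mul_sum]
        refine Finset.sum_congr rfl fun k _ => ?_
        rw [Real.sqrt_mul (hαpos _).le]
        simp only [PiLp.smul_apply, PiLp.sub_apply, smul_eq_mul]
        ring
      · rfl
    · filter_upwards [hint.filter_mono inf_le_left, mem_inf_of_right (mem_principal_self _)]
        with x h1 h2
      refine ⟨?_, h2⟩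
      simp only [norm_smul, mul_pow, mul_assoc]
      exact h1.const_mul _
  · obtain ⟨M, N, hM⟩ := hA3 ε hε ((p + 2 : ℕ) : ℝ) (Nat.cast_nonneg _)
    refine ⟨M, ?_⟩
    filter_upwards [hαn.eventually_ge_atTop (N : ℝ)] with n hn
    have h1 := (hM n hn).le
    simp only [Real.rpow_natCast] at h1
    simpa only [Set.mem_ofPred_eq, not_le] using h1
end
end

section
/- Proposition 2 (sufficient conditions for the Laplace remainder condition on b = q·π). Assume (A0). Assume π is strictly positive and twice continuously differentiable on the open ball B_{θ*}(γ) := {θ : ‖θ − θ*‖₂ < γ} for some γ > 0 and has finite mean ∫_{ℝ^p} ‖θ‖₂·π(θ) dθ < ∞. Let q : ℝ^p → ℝ be twice continuously differentiable on B_{θ*}(γ), set b := q·π, and assume M := p·sup_{θ ∈ B_{θ*}(γ)} max_{1 ≤ i,j ≤ p} |[∇²b(θ)]_{ij}| is finite. Let (α_n) be a positive sequence with α_n·n → ∞. Then condition (iii) of (ALap) holds for b with δ := γ/2, v := ∇b(θ̂) = π(θ̂)·∇q(θ̂) + q(θ̂)·∇π(θ̂) and this M: for every ε > 0 there exists N such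 that for all n with α_n·n > N, P_n( sup_{‖h‖₂ ≤ (γ/2)·√(α_n n)} [ b(θ̂ + h/√(α_n n)) − b(θ̂) − ∇b(θ̂)ᵀh/√(α_n n) − (M/(α_n n))·‖h‖₂² ] > 0 ) < ε. -/
open MeasureTheory Filter BigOperators

noncomputable section

/-- A bilinear form on Euclidean space whose coefficients satisfy `p * |B e_i e_j| ≤ M`
has operator norm at most `M`. -/
theorem norm_le_of_forall_mul_abs_basisE_le {p : ℕ} {M : ℝ} (hM0 : 0 ≤ M)
    (B : EuclideanSpace ℝ (Fin p) →L[ℝ] EuclideanSpace ℝ (Fin p) →L[ℝ] ℝ)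
    (hB : ∀ i j, (p : ℝ) * |B (basisE p i) (basisE p j)| ≤ M) : ‖B‖ ≤ M := by
  have expand (u : EuclideanSpace ℝ (Fin p)) : u = ∑ i, u i • basisE p i := by
    simpa [basisE] using ((EuclideanSpace.basisFun (Fin p) ℝ).sum_repr u).symm
  have sum_abs_le (u : EuclideanSpace ℝ (Fin p)) : ∑ i, |u i| ≤ √p * ‖u‖ := by
    rw [← Real.sqrt_sq (norm_nonneg u), ← Real.sqrt_mul (Nat.cast_nonneg p)]
    refine Real.le_sqrt_of_sq_le ?_
    simpa [EuclideanSpace.real_norm_sq_eq] using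
      sq_sum_le_card_mul_sum_sq (s := Finset.univ) (f := fun i => |u i|)
  refine B.opNorm_le_bound₂ hM0 fun u v => ?_
  rcases p.eq_zero_or_pos with rfl | hp
  · simp [Subsingleton.elim u 0]
  have hp' : (0 : ℝ) < p := by exact_mod_cast hp
  have hcoef (i j : Fin p) : |B (basisE p i) (basisE p j)| ≤ M / p := by
    rw [le_div_iff₀ hp', mul_comm]
    exact hB i j
  have heq : B u v = ∑ i, ∑ j, u i * (v j * B (basisE p i) (basisE p j)) := by
    conv_lhs => rw [expand u, expand v]
    simp only [map_sum, map_smul, sum_apply, smul_apply,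
      smul_eq_mul, Finset.mul_sum]
    rw [Finset.sum_comm]
    exact Finset.sum_congr rfl fun i _ => Finset.sum_congr rfl fun j _ => by ring
  calc ‖B u v‖ ≤ ∑ i, ∑ j, |u i| * (|v j| * (M / p)) := by
        rw [heq, Real.norm_eq_abs]
        refine (Finset.abs_sum_le_sum_abs _ _).trans (Finset.sum_le_sum fun i _ => ?_)
        refine (Finset.abs_sum_le_sum_abs _ _).trans (Finset.sum_le_sum fun j _ => ?_)
        rw [abs_mul, abs_mul]
        gcongr
        exact hcoef i j
    _ = (M / p) * ((∑ i, |u i|) * ∑ j, |v j|) := by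
        rw [Finset.sum_mul_sum, Finset.mul_sum]
        refine Finset.sum_congr rfl fun i _ => ?_
        rw [Finset.mul_sum]
        exact Finset.sum_congr rfl fun j _ => by ring
    _ ≤ (M / p) * ((√p * ‖u‖) * (√p * ‖v‖)) := by
        gcongr
        · exact sum_abs_le u
        · exact sum_abs_le v
    _ = M * ‖u‖ * ‖v‖ := by
        rw [mul_mul_mul_comm, Real.mul_self_sqrt hp'.le]
        field_simp

/-- First-order Taylor estimate for a function with bounded second partial derivatives
on a convex open set. -/
theorem norm_sub_sub_fderiv_le_of_d2_le {p : ℕ} {M : ℝ}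
    {s : Set (EuclideanSpace ℝ (Fin p))} (hs : IsOpen s) (hconv : Convex ℝ s)
    {b : EuclideanSpace ℝ (Fin p) → ℝ} (hb : ContDiffOn ℝ 2 b s)
    (hM : ∀ θ ∈ s, ∀ i j, (p : ℝ) * |d2 b θ i j| ≤ M)
    {x y : EuclideanSpace ℝ (Fin p)} (hx : x ∈ s) (hy : y ∈ s) :
    ‖b y - b x - fderiv ℝ b x (y - x)‖ ≤ M * ‖y - x‖ ^ 2 := by
  rcases p.eq_zero_or_pos with rfl | hp
  · simp [Subsingleton.elim y x]
  have hM0 : 0 ≤ M := (by positivity : (0 : ℝ) ≤ _).trans (hM x hx ⟨0, hp⟩ ⟨0, hp⟩)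
  have hdiff (z) (hz : z ∈ s) : DifferentiableAt ℝ b z :=
    (hb.contDiffAt (hs.mem_nhds hz)).differentiableAt (by norm_num)
  have hdiff2 (z) (hz : z ∈ s) : DifferentiableAt ℝ (fderiv ℝ b) z :=
    ((hb.contDiffAt (hs.mem_nhds hz)).fderiv_right (m := 1) (by norm_num)).differentiableAt
      (by norm_num)
  have hbound (z) (hz : z ∈ s) : ‖fderiv ℝ (fderiv ℝ b) z‖ ≤ M := by
    refine norm_le_of_forall_mul_abs_basisE_le hM0 _ fun i j => ?_
    have h := hM z hz i j
    have hd2 : d2 b z i j = fderiv ℝ (fderiv ℝ b) z (basisE p i) (basisE p j) := by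
      unfold d2 d1
      rw [fderiv_clm_apply (hdiff2 z hz) (differentiableAt_const _)]
      simp
    rwa [hd2] at h
  have hseg : segment ℝ x y ⊆ s := hconv.segment_subset hx hy
  have hlip : ∀ z ∈ segment ℝ x y, ‖fderiv ℝ b z - fderiv ℝ b x‖ ≤ M * ‖y - x‖ := fun z hz =>
    (hconv.norm_image_sub_le_of_norm_fderiv_le hdiff2 hbound hx (hseg hz)).trans <|
      mul_le_mul_of_nonneg_left (norm_sub_le_of_mem_segment hz) hM0
  have h := (convex_segment x y).norm_image_sub_le_of_norm_hasFDerivWithin_le'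
    (fun z hz => (hdiff z (hseg hz)).hasFDerivAt.hasFDerivWithinAt) hlip
    (left_mem_segment ℝ x y) (right_mem_segment ℝ x y)
  rwa [mul_assoc, ← sq] at h

/-- If a property holds eventually, it holds wherever a given real sequence is large. -/
theorem exists_nat_forall_lt_of_eventually {Q : ℕ → Prop} (hQ : ∀ᶠ n in atTop, Q n)
    (a : ℕ → ℝ) : ∃ N : ℕ, ∀ n, (N : ℝ) < a n → Q n := by
  obtain ⟨n₀, hn₀⟩ := eventually_atTop.1 hQ
  obtain ⟨C, hC⟩ := ((Finset.range n₀).image a).bddAbove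
  obtain ⟨N, hN⟩ := exists_nat_ge C
  refine ⟨N, fun n hn => hn₀ n ?_⟩
  by_contra! hlt
  exact (hC (Finset.mem_coe.2 (Finset.mem_image_of_mem a (Finset.mem_range.2 hlt)))).not_gt
    (hN.trans_lt hn)

/-- **Proposition 2** (sufficient conditions for the Laplace remainder condition on
`b = q·π`, i.e., condition (iii) of (ALap)). -/
theorem sufficient_conditions_for_ALap
    {p : ℕ} {Ω : ℕ → Type} [∀ n, MeasurableSpace (Ω n)]
    (P : ∀ n, Measure (Ω n)) [∀ n, IsProbabilityMeasure (P n)]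
    (prior : EuclideanSpace ℝ (Fin p) → ℝ)
    (θhat : ∀ n, Ω n → EuclideanSpace ℝ (Fin p))
    (θstar : EuclideanSpace ℝ (Fin p))
    (α : ℕ → ℝ) (γ : ℝ) (M : ℝ)
    (q : EuclideanSpace ℝ (Fin p) → ℝ)
    (hθmeas : ∀ n, Measurable (θhat n))
    -- assumption (A0)
    (hA0 : A0 P θhat θstar)
    -- regularity of the prior near `θstar` and finite prior mean
    (hγ : 0 < γ)
    (hpriorpos : ∀ θ ∈ Metric.ball θstar γ, 0 < prior θ)
    (hpriorC2 : ContDiffOn ℝ 2 prior (Metric.ball θstar γ))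
    (hpriormean : Integrable (fun θ : EuclideanSpace ℝ (Fin p) => ‖θ‖ * prior θ))
    (hpriordens : (∀ θ, 0 ≤ prior θ) ∧ Measurable prior ∧ ∫ θ, prior θ = 1)
    -- regularity of `q` near `θstar`
    (hqC2 : ContDiffOn ℝ 2 q (Metric.ball θstar γ))
    -- `M = p · sup_{θ ∈ B(θ*,γ)} max_{i,j} |[∇²(q·π)(θ)]_{ij}|`, assumed finite:
    -- `M` is an upper bound for `p · |[∇²(q·π)(θ)]_{ij}|` on the ball
    (hM : ∀ θ ∈ Metric.ball θstar γ, ∀ i j : Fin p,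
      (p : ℝ) * |d2 (fun θ' => q θ' * prior θ') θ i j| ≤ M)
    -- tempering sequence: `α n * n → ∞`
    (hαpos : ∀ n, 0 < α n)
    (hαn : Tendsto (fun n => α n * (n : ℝ)) atTop atTop) :
    ∀ ε : ℝ, 0 < ε → ∃ N : ℕ, ∀ n : ℕ, (N : ℝ) < α n * n →
      P n {ω | ∃ h : EuclideanSpace ℝ (Fin p), ‖h‖ ≤ (γ / 2) * Real.sqrt (α n * (n : ℝ)) ∧
        fderiv ℝ (fun θ' => q θ' * prior θ') (θhat n ω) h / Real.sqrt (α n * (n : ℝ))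
            + (M / (α n * (n : ℝ))) * ‖h‖ ^ 2 <
          q (θhat n ω + (Real.sqrt (α n * (n : ℝ)))⁻¹ • h) *
              prior (θhat n ω + (Real.sqrt (α n * (n : ℝ)))⁻¹ • h)
            - q (θhat n ω) * prior (θhat n ω)} < ENNReal.ofReal ε := by
  intro ε hε
  have hev : ∀ᶠ n in atTop, P n {ω | γ / 4 < ‖θhat n ω - θstar‖} < ENNReal.ofReal ε :=
    (hA0.1 (γ / 4) (by positivity)).eventually_lt_const (ENNReal.ofReal_pos.2 hε)
  obtain ⟨N, hN⟩ := exists_nat_forall_lt_of_eventually hev fun n => α n * (n : ℝ)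
  refine ⟨N, fun n hn => (measure_mono ?_).trans_lt (hN n hn)⟩
  rintro ω ⟨h, hh, hlt⟩
  rw [Set.mem_ofPred_eq]
  by_contra! hle
  have ht : 0 < α n * (n : ℝ) := (Nat.cast_nonneg N).trans_lt hn
  have hr : 0 < √(α n * (n : ℝ)) := Real.sqrt_pos.2 ht
  have hnorm : ‖(√(α n * (n : ℝ)))⁻¹ • h‖ = ‖h‖ / √(α n * (n : ℝ)) := by
    rw [norm_smul, norm_inv, Real.norm_of_nonneg hr.le, inv_mul_eq_div]
  have hx : θhat n ω ∈ Metric.ball θstar γ := by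
    rw [mem_ball_iff_norm]
    linarith
  have hy : θhat n ω + (√(α n * (n : ℝ)))⁻¹ • h ∈ Metric.ball θstar γ := by
    have hstep := (div_le_iff₀ hr).2 hh
    rw [mem_ball_iff_norm, add_sub_right_comm]
    refine (norm_add_le _ _).trans_lt ?_
    rw [hnorm]
    linarith
  have key := (le_abs_self _).trans <| norm_sub_sub_fderiv_le_of_d2_le Metric.isOpen_ball
    (convex_ball θstar γ) (hqC2.mul hpriorC2) hM hx hy
  rw [add_sub_cancel_left, hnorm, map_smul, smul_eq_mul, inv_mul_eq_div, div_pow,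
    Real.sq_sqrt ht.le, mul_div_assoc', ← div_mul_eq_mul_div] at key
  linarith
end
end

section
/- Proposition C.2 (salience and local quadratic behavior of the likelihood imply uniformly bounded posterior moments, i.e., sufficient conditions for (A3)). Let (α_n) be a positive sequence with α_n → 0 and α_n·n → ∞. Assume (A0) and (A1), assume π(θ) ≤ κ for all θ ∈ ℝ^p for some constant κ > 0, and assume Conditions 1 and 2. Then (A3) holds: for every ε > 0 and every k₀ ≥ 0 there exist a constant M < ∞ and an integer N such that for all n with α_n·n ≥ N, P_n( ∫_{ℝ^p} ‖√(α_n n)(θ − θ*)‖₂^{k₀}·π_{n,α_n}(θ|X^n) dθ > M ) < ε. -/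
open MeasureTheory Filter BigOperators

noncomputable section

open scoped Topology

/-- A lower bound `c` on a ball of radius `t` gives a lower bound on the integral. -/
theorem mul_pow_finrank_mul_le_integral {E : Type*} [NormedAddCommGroup E] [NormedSpace ℝ E]
    [FiniteDimensional ℝ E] [MeasurableSpace E] [BorelSpace E] (μ : Measure E) [μ.IsAddHaarMeasure]
    {g : E → ℝ} (hg : ∀ θ, 0 ≤ g θ) (hgi : Integrable g μ) {x : E} {c t : ℝ} (ht : 0 < t)
    (h : ∀ᵐ θ ∂μ, ‖θ - x‖ < t → c ≤ g θ) :
    c * (t ^ Module.finrank ℝ E * μ.real (Metric.ball 0 1)) ≤ ∫ θ, g θ ∂μ := by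
  have hball : μ.real (Metric.ball x t) = t ^ Module.finrank ℝ E * μ.real (Metric.ball 0 1) := by
    rw [measureReal_def, Measure.addHaar_ball_of_pos μ x ht, ENNReal.toReal_mul,
      ENNReal.toReal_ofReal (by positivity), measureReal_def]
  calc c * (t ^ Module.finrank ℝ E * μ.real (Metric.ball 0 1))
      = ∫ _ in Metric.ball x t, c ∂μ := by
        rw [setIntegral_const, hball, smul_eq_mul, mul_comm]
    _ ≤ ∫ θ in Metric.ball x t, g θ ∂μ := by
        refine setIntegral_mono_on_ae (integrableOn_const measure_ball_lt_top.ne)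
          hgi.integrableOn Metric.isOpen_ball.measurableSet ?_
        filter_upwards [h] with θ hθ hmem
        exact hθ (by simpa [dist_eq_norm] using hmem)
    _ ≤ ∫ θ, g θ ∂μ := setIntegral_le_integral hgi (ae_of_all _ hg)

/-- Shifted absolute moments of a centered Gaussian weight are finite. -/
theorem integrable_norm_add_rpow_mul_exp_neg {E : Type*} [NormedAddCommGroup E] [NormedSpace ℝ E]
    [FiniteDimensional ℝ E] [MeasurableSpace E] [BorelSpace E] (μ : Measure E) [μ.IsAddHaarMeasure]
    {k R c : ℝ} (hk : 0 ≤ k) (hR : 0 ≤ R) (hc : 0 < c) :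
    Integrable (fun u : E => (‖u‖ + R) ^ k * Real.exp (-(c * ‖u‖ ^ 2))) μ := by
  set q : ℝ := Module.finrank ℝ E + 1 with hq
  have hlim : Tendsto (fun x : ℝ => (x + (R + 1)) ^ (k + q) * Real.exp (-(c * x ^ 2)))
      atTop (𝓝 0) := by
    have h1 : Tendsto (fun y : ℝ => y ^ (k + q) * Real.exp (-c * y)) atTop (𝓝 0) :=
      tendsto_rpow_mul_exp_neg_mul_atTop_nhds_zero _ _ hc
    have h2 : Tendsto (fun x : ℝ => x + (R + 1)) atTop atTop :=
      tendsto_atTop_add_const_right _ _ tendsto_id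
    have h3 := (h1.comp h2).mul_const (Real.exp (c * (R + 1)))
    rw [zero_mul] at h3
    refine squeeze_zero' ?_ ?_ h3
    · filter_upwards [eventually_ge_atTop 0] with x hx
      positivity
    · filter_upwards [eventually_ge_atTop 1] with x hx
      simp only [Function.comp]
      rw [mul_assoc, ← Real.exp_add]
      gcongr
      nlinarith [mul_nonneg hc.le (mul_nonneg (by linarith : 0 ≤ x) (by linarith : 0 ≤ x - 1))]
  have hcont : Continuous (fun x : ℝ => (|x| + (R + 1)) ^ (k + q) * Real.exp (-(c * x ^ 2))) := by
    refine Continuous.mul (Continuous.rpow_const (by fun_prop) fun x => Or.inl ?_) (by fun_prop)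
    positivity
  obtain ⟨C, hC⟩ : ∃ C : ℝ, ∀ x : ℝ, 0 ≤ x →
      (x + (R + 1)) ^ (k + q) * Real.exp (-(c * x ^ 2)) ≤ C := by
    obtain ⟨B, hB⟩ := eventually_atTop.1 (hlim.eventually_le_const zero_lt_one)
    obtain ⟨C, hC⟩ := (isCompact_Icc (a := 0) (b := B)).bddAbove_image hcont.continuousOn
    refine ⟨max C 1, fun x hx => ?_⟩
    rcases le_total x B with hxB | hxB
    · have := hC ⟨x, ⟨hx, hxB⟩, rfl⟩
      simp only [abs_of_nonneg hx] at this
      exact this.trans (le_max_left _ _)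
    · exact (hB x hxB).trans (le_max_right _ _)
  have hint : Integrable (fun u : E => C * (1 + ‖u‖) ^ (-q)) μ :=
    (integrable_one_add_norm (by rw [hq]; linarith)).const_mul C
  refine hint.mono' ?_ (ae_of_all _ fun u => ?_)
  · refine Measurable.aestronglyMeasurable ?_
    fun_prop
  · have hu := norm_nonneg u
    rw [Real.norm_of_nonneg (by positivity), Real.rpow_neg (by positivity), ← div_eq_mul_inv,
      le_div_iff₀ (by positivity)]
    refine le_trans ?_ (hC ‖u‖ hu)
    rw [Real.rpow_add (by positivity : 0 < ‖u‖ + (R + 1)) k q, mul_right_comm]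
    have hq0 : 0 ≤ q := by positivity
    have h1 : (‖u‖ + R) ^ k ≤ (‖u‖ + (R + 1)) ^ k :=
      Real.rpow_le_rpow (by positivity) (by linarith) hk
    have h2 : (1 + ‖u‖) ^ q ≤ (‖u‖ + (R + 1)) ^ q :=
      Real.rpow_le_rpow (by positivity) (by linarith) hq0
    exact mul_le_mul_of_nonneg_right (mul_le_mul h1 h2 (by positivity) (by positivity))
      (by positivity)

/-- Upper bound for a rescaled moment of a weight `w` with a Gaussian bound near `θ₀` and a
bound by a multiple of a probability density away from `θ₀`. -/
theorem integral_rescaled_moment_le {E : Type*} [NormedAddCommGroup E] [NormedSpace ℝ E]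
    [FiniteDimensional ℝ E] [MeasurableSpace E] [BorelSpace E] (μ : Measure E) [μ.IsAddHaarMeasure]
    {w q : E → ℝ} {θ₀ x : E} {k r κ c s R D : ℝ} (hk : 0 ≤ k) (hR : 0 ≤ R) (hc : 0 < c)
    (hs : 0 < s) (hD : 0 ≤ D) (hκ : 0 ≤ κ) (hw : ∀ θ, 0 ≤ w θ) (hq : ∀ θ, 0 ≤ q θ)
    (hq1 : ∫ θ, q θ ∂μ = 1) (hx : s * ‖x - θ₀‖ ≤ R)
    (hnear : ∀ᵐ θ ∂μ, ‖θ - θ₀‖ < r → w θ ≤ κ * Real.exp (-(c * (s * ‖θ - x‖) ^ 2)))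
    (hfar : ∀ᵐ θ ∂μ, r ≤ ‖θ - θ₀‖ → ‖θ - θ₀‖ ^ k * w θ ≤ D * q θ) :
    ∫ θ, ‖s • (θ - θ₀)‖ ^ k * w θ ∂μ ≤
      κ * ((s ^ Module.finrank ℝ E)⁻¹ *
        ∫ u, (‖u‖ + R) ^ k * Real.exp (-(c * ‖u‖ ^ 2)) ∂μ) + s ^ k * D := by
  set F : E → ℝ := fun u => (‖u‖ + R) ^ k * Real.exp (-(c * ‖u‖ ^ 2)) with hF
  have hFi : Integrable F μ := integrable_norm_add_rpow_mul_exp_neg μ hk hR hc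
  have hF0 : ∀ u, 0 ≤ F u := fun u => by positivity
  have hqi : Integrable q μ := by
    by_contra h
    rw [integral_undef h] at hq1
    exact zero_ne_one hq1
  have hFs : Integrable (fun θ => F (s • (θ - x))) μ :=
    (hFi.comp_smul hs.ne').comp_sub_right x
  have hval : ∫ θ, F (s • (θ - x)) ∂μ = (s ^ Module.finrank ℝ E)⁻¹ * ∫ u, F u ∂μ := by
    rw [integral_sub_right_eq_self (fun θ => F (s • θ)) x, Measure.integral_comp_smul,
      abs_of_nonneg (by positivity), smul_eq_mul]
  calc ∫ θ, ‖s • (θ - θ₀)‖ ^ k * w θ ∂μ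
      ≤ ∫ θ, (κ * F (s • (θ - x)) + s ^ k * D * q θ) ∂μ := by
        refine integral_mono_of_nonneg (ae_of_all _ fun θ => mul_nonneg (by positivity) (hw θ))
          ((hFs.const_mul κ).add (hqi.const_mul _)) ?_
        filter_upwards [hnear, hfar] with θ h1 h2
        have hq0 : 0 ≤ s ^ k * D * q θ := mul_nonneg (by positivity) (hq θ)
        have hF0' : 0 ≤ κ * F (s • (θ - x)) := mul_nonneg hκ (hF0 _)
        have hsn (y : E) : ‖s • y‖ = s * ‖y‖ := by rw [norm_smul, Real.norm_of_nonneg hs.le]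
        rcases lt_or_ge ‖θ - θ₀‖ r with hlt | hge
        · refine le_trans ?_ (le_add_of_nonneg_right hq0)
          have htri : ‖s • (θ - θ₀)‖ ≤ ‖s • (θ - x)‖ + R := by
            rw [hsn, hsn]
            have : ‖θ - θ₀‖ ≤ ‖θ - x‖ + ‖x - θ₀‖ := norm_sub_le_norm_sub_add_norm_sub _ _ _
            nlinarith
          calc ‖s • (θ - θ₀)‖ ^ k * w θ
              ≤ (‖s • (θ - x)‖ + R) ^ k * (κ * Real.exp (-(c * (s * ‖θ - x‖) ^ 2))) := by
                gcongr
                · exact hw θ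
                · exact h1 hlt
            _ = κ * F (s • (θ - x)) := by rw [hF]; simp only [hsn]; ring
        · refine le_trans ?_ (le_add_of_nonneg_left hF0')
          rw [hsn, Real.mul_rpow hs.le (norm_nonneg _), mul_assoc, mul_assoc]
          exact mul_le_mul_of_nonneg_left (h2 hge) (by positivity)
    _ = κ * ((s ^ Module.finrank ℝ E)⁻¹ * ∫ u, F u ∂μ) + s ^ k * D := by
        rw [integral_add (hFs.const_mul κ) (hqi.const_mul _), integral_const_mul,
          integral_const_mul, hq1, hval, mul_one]

/-- A logarithmic penalty of strength `b` beats the `k`-th power beyond radius `r`. -/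
theorem rpow_mul_exp_neg_log_le {c₀ c₁ c₂ r k B v : ℝ} (hc₀ : 0 < c₀) (hc₁ : 0 < c₁) (hr : 0 < r)
    (hB : 0 ≤ B) (hkB : k ≤ B * c₀) (hv : r ≤ v) :
    v ^ k * Real.exp (-(B * (c₀ * Real.log (1 + c₁ * v) - c₂))) ≤
      r ^ k * Real.exp (-(B * (c₀ * Real.log (c₁ * r) - c₂))) := by
  have hv0 : 0 < v := hr.trans_le hv
  rw [Real.rpow_def_of_pos hv0, Real.rpow_def_of_pos hr, ← Real.exp_add, ← Real.exp_add]
  refine Real.exp_le_exp.2 ?_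
  have h1 : Real.log (c₁ * v) ≤ Real.log (1 + c₁ * v) :=
    Real.log_le_log (by positivity) (by linarith)
  have h2 : Real.log r ≤ Real.log v := Real.log_le_log hr hv
  rw [Real.log_mul hc₁.ne' hv0.ne'] at h1
  rw [Real.log_mul hc₁.ne' hr.ne']
  nlinarith [mul_nonneg (sub_nonneg.2 hkB) (sub_nonneg.2 h2),
    mul_nonneg (mul_nonneg hB hc₀.le) (sub_nonneg.2 h1)]

/-- An event on which a jointly measurable relation holds for every parameter, of outer
probability tending to one, yields a relation holding for almost every parameter, outside an event
of probability tending to zero. -/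
theorem tendsto_measure_not_ae_of_subset {Ω : ℕ → Type*} [∀ n, MeasurableSpace (Ω n)]
    (P : ∀ n, Measure (Ω n)) [∀ n, IsProbabilityMeasure (P n)] {E : Type*} [MeasurableSpace E]
    (μ : Measure E) [SFinite μ] {A : ∀ n, Set (Ω n)} {B : ∀ n, Set (Ω n × E)}
    (hA : Tendsto (fun n => P n (A n)) atTop (𝓝 1)) (hB : ∀ n, MeasurableSet (B n))
    (hAB : ∀ n, ∀ ω ∈ A n, ∀ θ, (ω, θ) ∈ B n) :
    Tendsto (fun n => P n {ω | ¬ ∀ᵐ θ ∂μ, (ω, θ) ∈ B n}) atTop (𝓝 0) := by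
  have hmeas : ∀ n, MeasurableSet {ω | ∀ᵐ θ ∂μ, (ω, θ) ∈ B n} := fun n =>
    measurable_measure_prodMk_left (ν := μ) (hB n).compl (measurableSet_singleton 0)
  have h1 : Tendsto (fun n => P n {ω | ∀ᵐ θ ∂μ, (ω, θ) ∈ B n}) atTop (𝓝 1) :=
    tendsto_of_tendsto_of_tendsto_of_le_of_le hA tendsto_const_nhds
      (fun n => measure_mono fun ω hω => ae_of_all _ (hAB n ω hω)) (fun n => prob_le_one)
  have h2 : Tendsto (fun n => 1 - P n {ω | ∀ᵐ θ ∂μ, (ω, θ) ∈ B n}) atTop (𝓝 (1 - 1)) :=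
    ENNReal.Tendsto.sub tendsto_const_nhds h1 (Or.inl ENNReal.one_ne_top)
  rw [tsub_self] at h2
  refine h2.congr fun n => ?_
  rw [← prob_compl_eq_one_sub (hmeas n)]
  rfl

/-- Under `A0` the rescaled estimation error is tight. -/
theorem A0.exists_eventually_measure_lt {p : ℕ} {Ω : ℕ → Type} [∀ n, MeasurableSpace (Ω n)]
    {P : ∀ n, Measure (Ω n)} [∀ n, IsProbabilityMeasure (P n)]
    {θhat : ∀ n, Ω n → EuclideanSpace ℝ (Fin p)} {θstar : EuclideanSpace ℝ (Fin p)}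
    (h : A0 P θhat θstar) (hθ : ∀ n, Measurable (θhat n)) {ε : ℝ} (hε : 0 < ε) :
    ∃ R : ℝ, 0 < R ∧ ∀ᶠ n : ℕ in atTop,
      P n {ω | R < Real.sqrt n * ‖θhat n ω - θstar‖} < ENNReal.ofReal ε := by
  obtain ⟨-, S, -, -, hw⟩ := h
  set g := gaussDensity p 0 S with hg
  have hg1 : ∫ x, g x = 1 := by
    have h1 := hw (fun _ => 1) continuous_const ⟨1, by simp⟩
    simp only [integral_const, probReal_univ, one_mul, smul_eq_mul, mul_one] at h1
    exact tendsto_nhds_unique h1 tendsto_const_nhds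
  have hgi : Integrable g := by
    by_contra h
    rw [integral_undef h] at hg1
    exact zero_ne_one hg1
  let f : ℝ → EuclideanSpace ℝ (Fin p) → ℝ := fun R x => min 1 (max 0 (‖x‖ - R))
  have hf0 : ∀ R x, 0 ≤ f R x := fun R x => le_min zero_le_one (le_max_left _ _)
  have hf1 : ∀ R x, f R x ≤ 1 := fun R x => min_le_left _ _
  have hfc : ∀ R, Continuous (f R) := fun R => by fun_prop
  have habs : ∀ R x, |f R x| ≤ 1 := fun R x => by rw [abs_of_nonneg (hf0 R x)]; exact hf1 R x
  have hlim : Tendsto (fun R : ℝ => ∫ x, f R x * g x) atTop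
      (𝓝 (∫ _ : EuclideanSpace ℝ (Fin p), (0 : ℝ))) := by
    refine tendsto_integral_filter_of_dominated_convergence (fun x => ‖g x‖)
      (Eventually.of_forall fun R => (hfc R).aestronglyMeasurable.mul hgi.aestronglyMeasurable)
      (Eventually.of_forall fun R => ae_of_all _ fun x => ?_) hgi.norm (ae_of_all _ fun x => ?_)
    · rw [norm_mul, Real.norm_eq_abs (f R x)]
      exact mul_le_of_le_one_left (norm_nonneg _) (habs R x)
    · refine tendsto_const_nhds.congr' ?_
      filter_upwards [eventually_ge_atTop ‖x‖] with R hR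
      simp [f, max_eq_left (sub_nonpos.2 hR)]
  rw [integral_zero] at hlim
  obtain ⟨R, hRε, hR0⟩ := ((hlim.eventually_lt_const hε).and (eventually_gt_atTop 0)).exists
  refine ⟨R + 1, by linarith, ?_⟩
  filter_upwards [(hw (f R) (hfc R) ⟨1, habs R⟩).eventually_lt_const hRε] with n hn
  have hY : Measurable fun ω => Real.sqrt n • (θhat n ω - θstar) :=
    ((hθ n).sub_const θstar).const_smul (Real.sqrt n)
  have hfi : Integrable (fun ω => f R (Real.sqrt n • (θhat n ω - θstar))) (P n) :=
    Integrable.of_bound ((hfc R).measurable.comp hY).aestronglyMeasurable 1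
      (ae_of_all _ fun ω => habs R _)
  have hmk := mul_meas_ge_le_integral_of_nonneg (ae_of_all _ fun ω => hf0 R _) hfi 1
  rw [one_mul] at hmk
  refine lt_of_le_of_lt (measure_mono ?_)
    ((ENNReal.lt_ofReal_iff_toReal_lt (measure_ne_top _ _)).2 (hmk.trans_lt hn))
  intro ω hω
  rw [Set.mem_ofPred_eq] at hω ⊢
  have hnorm : ‖Real.sqrt n • (θhat n ω - θstar)‖ = Real.sqrt n * ‖θhat n ω - θstar‖ := by
    rw [norm_smul, Real.norm_of_nonneg (Real.sqrt_nonneg _)]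
  refine le_min le_rfl (le_max_of_le_right ?_)
  rw [hnorm]
  linarith

/-- If `α` is bounded, `α n * n` being large forces `n` to be large. -/
theorem exists_nat_forall_of_eventually {α : ℕ → ℝ} (hα : BddAbove (Set.range α)) {q : ℕ → Prop}
    (h : ∀ᶠ n in atTop, q n) : ∃ N : ℕ, ∀ n : ℕ, (N : ℝ) ≤ α n * n → q n := by
  obtain ⟨n₀, hn₀⟩ := eventually_atTop.1 h
  obtain ⟨A, hA⟩ := hα
  have hA' : ∀ n, α n ≤ max A 1 := fun n => (hA ⟨n, rfl⟩).trans (le_max_left _ _)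
  refine ⟨⌈max A 1 * n₀⌉₊, fun n hn => hn₀ n ?_⟩
  have h1 : max A 1 * n₀ ≤ max A 1 * n :=
    ((Nat.le_ceil _).trans hn).trans (mul_le_mul_of_nonneg_right (hA' n) n.cast_nonneg)
  exact_mod_cast le_of_mul_le_mul_left h1 (lt_max_of_lt_right zero_lt_one)

/-- A power of `y` in terms of the same power of a reference value `z`. -/
theorem rpow_eq_rpow_mul_exp_log_sub {y z : ℝ} (hy : 0 < y) (hz : 0 < z) (a : ℝ) :
    y ^ a = z ^ a * Real.exp (a * (Real.log y - Real.log z)) := by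
  rw [Real.rpow_def_of_pos hy, Real.rpow_def_of_pos hz, ← Real.exp_add]
  ring_nf

/-- Posterior integrals in terms of likelihood ratios with respect to a reference parameter. -/
theorem integral_mul_post_eq {p : ℕ} {Ω : Type} {L : Ω → EuclideanSpace ℝ (Fin p) → ℝ}
    {prior : EuclideanSpace ℝ (Fin p) → ℝ} {α : ℝ} {ω : Ω} (hL : ∀ θ, 0 < L ω θ)
    (x : EuclideanSpace ℝ (Fin p)) (φ : EuclideanSpace ℝ (Fin p) → ℝ) :
    ∫ θ, φ θ * post L prior α ω θ =
      (∫ θ, φ θ * (Real.exp (α * (Real.log (L ω θ) - Real.log (L ω x))) * prior θ)) /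
        ∫ θ, Real.exp (α * (Real.log (L ω θ) - Real.log (L ω x))) * prior θ := by
  have hc : (L ω x ^ α) ≠ 0 := (Real.rpow_pos_of_pos (hL x) α).ne'
  have hw : ∀ θ, L ω θ ^ α * prior θ =
      L ω x ^ α * (Real.exp (α * (Real.log (L ω θ) - Real.log (L ω x))) * prior θ) := fun θ => by
    rw [rpow_eq_rpow_mul_exp_log_sub (hL θ) (hL x), mul_assoc]
  simp only [post, hw, integral_const_mul]
  rw [← integral_div]
  refine integral_congr_ae (ae_of_all _ fun θ => ?_)
  simp only
  rw [mul_div_mul_left _ _ hc, ← mul_div_assoc]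

/-- Moment bound for the tempered posterior at a data point at which the log-likelihood is
sandwiched between quadratics around `x` and has a logarithmic penalty away from `θstar`. -/
theorem integral_norm_rpow_mul_post_le {p : ℕ} {Ω : Type}
    {L : Ω → EuclideanSpace ℝ (Fin p) → ℝ} {prior : EuclideanSpace ℝ (Fin p) → ℝ} {ω : Ω}
    {θstar x : EuclideanSpace ℝ (Fin p)} {α n κ m δ R k Lc c₀ c₁ c₂ c₃ c₄ r : ℝ}
    (hL : ∀ θ, 0 < L ω θ) (hprior0 : ∀ θ, 0 ≤ prior θ) (hprior1 : ∫ θ, prior θ = 1)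
    (hpriorκ : ∀ θ, prior θ ≤ κ) (hκ : 0 ≤ κ) (hm : 0 < m)
    (hpriorm : ∀ θ, ‖θ - θstar‖ < δ → m ≤ prior θ)
    (hZ : Integrable fun θ => L ω θ ^ α * prior θ)
    (hx : ∀ θ, L ω θ ≤ L ω x) (hα : 0 < α) (hn : 0 < n) (hk : 0 ≤ k) (hR : 0 ≤ R)
    (hLc : 0 < Lc) (hc₀ : 0 < c₀) (hc₁ : 0 < c₁) (hc₃ : 0 < c₃) (hc₄ : 0 < c₄) (hr : 0 < r)
    (hxR : Real.sqrt (α * n) * ‖x - θstar‖ ≤ R) (hxr : ‖x - θstar‖ < r)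
    (hxδ : ‖x - θstar‖ < δ / 2) (hsδ : (Real.sqrt (α * n))⁻¹ < δ / 2)
    (hsr : (Real.sqrt (α * n))⁻¹ < 2 * r) (hkn : k ≤ α * n * Lc * c₀)
    (hdecay : Real.sqrt (α * n) ^ p * (Real.sqrt (α * n) ^ k *
      (r ^ k * Real.exp (-(α * n * Lc * (c₀ * Real.log (c₁ * r) - c₂))))) ≤ 1)
    (hfar : ∀ᵐ θ, r ≤ ‖θ - θstar‖ → Real.log (L ω θ) - Real.log (L ω θstar) ≤
      -(Lc * n * (c₀ * Real.log (1 + c₁ * ‖θ - θstar‖) - c₂)))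
    (hnear : ∀ᵐ θ, ‖θ - x‖ < 2 * r →
      -(n * c₃ * ‖θ - x‖ ^ 2) ≤ Real.log (L ω θ) - Real.log (L ω x) ∧
        Real.log (L ω θ) - Real.log (L ω x) ≤ -(n * c₄ * ‖θ - x‖ ^ 2)) :
    ∫ θ, ‖Real.sqrt (α * n) • (θ - θstar)‖ ^ k * post L prior α ω θ ≤
      (κ * (∫ u : EuclideanSpace ℝ (Fin p), (‖u‖ + R) ^ k * Real.exp (-(c₄ * ‖u‖ ^ 2))) + 1) /
        (m * Real.exp (-c₃) *
          (volume : Measure (EuclideanSpace ℝ (Fin p))).real (Metric.ball 0 1)) := by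
  set s := Real.sqrt (α * n) with hs_def
  have hs : 0 < s := Real.sqrt_pos.2 (mul_pos hα hn)
  have hs2 : s ^ 2 = α * n := Real.sq_sqrt (mul_pos hα hn).le
  set w : EuclideanSpace ℝ (Fin p) → ℝ := fun θ =>
    Real.exp (α * (Real.log (L ω θ) - Real.log (L ω x))) * prior θ with hw_def
  have hw0 : ∀ θ, 0 ≤ w θ := fun θ => mul_nonneg (Real.exp_pos _).le (hprior0 θ)
  have hwi : Integrable w := by
    refine (hZ.const_mul (L ω x ^ α)⁻¹).congr (ae_of_all _ fun θ => ?_)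
    have hc : (L ω x ^ α) ≠ 0 := (Real.rpow_pos_of_pos (hL x) α).ne'
    simp only [rpow_eq_rpow_mul_exp_log_sub (hL θ) (hL x) α, hw_def]
    rw [mul_assoc, inv_mul_cancel_left₀ hc]
  set V := (volume : Measure (EuclideanSpace ℝ (Fin p))).real (Metric.ball 0 1) with hV_def
  have hV : 0 < V := ENNReal.toReal_pos (Metric.measure_ball_pos _ _ one_pos).ne'
    measure_ball_lt_top.ne
  set I := ∫ u : EuclideanSpace ℝ (Fin p), (‖u‖ + R) ^ k * Real.exp (-(c₄ * ‖u‖ ^ 2)) with hI_def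
  have hI : 0 ≤ I := integral_nonneg fun u => by positivity
  have hden : m * Real.exp (-c₃) * (s⁻¹ ^ p * V) ≤ ∫ θ, w θ := by
    have := mul_pow_finrank_mul_le_integral volume hw0 hwi (x := x) (c := m * Real.exp (-c₃))
      (inv_pos.2 hs) ?_
    · rwa [finrank_euclideanSpace_fin] at this
    filter_upwards [hnear] with θ hθ hlt
    have h1 := (hθ (hlt.trans hsr)).1
    have h2 : m ≤ prior θ := hpriorm θ (by
      have := norm_sub_le_norm_sub_add_norm_sub θ x θstar
      linarith)
    have h3 : s * ‖θ - x‖ ≤ 1 := 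
      (mul_le_mul_of_nonneg_left hlt.le hs.le).trans_eq (mul_inv_cancel₀ hs.ne')
    have h4 : α * n * ‖θ - x‖ ^ 2 ≤ 1 := by
      rw [← hs2, ← mul_pow]
      exact pow_le_one₀ (by positivity) h3
    rw [hw_def, mul_comm m]
    refine mul_le_mul (Real.exp_le_exp.2 ?_) h2 hm.le (Real.exp_pos _).le
    nlinarith [mul_le_mul_of_nonneg_left h1 hα.le]
  have hnum : ∫ θ, ‖s • (θ - θstar)‖ ^ k * w θ ≤ κ * ((s ^ p)⁻¹ * I) + s ^ k *
      (r ^ k * Real.exp (-(α * n * Lc * (c₀ * Real.log (c₁ * r) - c₂)))) := by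
    have := integral_rescaled_moment_le volume (w := w) (q := prior) (θ₀ := θstar) (x := x)
      (D := r ^ k * Real.exp (-(α * n * Lc * (c₀ * Real.log (c₁ * r) - c₂))))
      (r := r) (κ := κ) hk hR hc₄ hs (by positivity) hκ hw0 hprior0 hprior1 hxR ?_ ?_
    · rwa [finrank_euclideanSpace_fin] at this
    · filter_upwards [hnear] with θ hθ hlt
      have h1 := (hθ (by
        have := norm_sub_le_norm_sub_add_norm_sub θ θstar x
        rw [norm_sub_rev θstar x] at this
        linarith)).2
      rw [hw_def, mul_comm κ]
      refine mul_le_mul (Real.exp_le_exp.2 ?_) (hpriorκ θ) (hprior0 θ) (Real.exp_pos _).le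
      rw [mul_pow, hs2]
      nlinarith [mul_le_mul_of_nonneg_left h1 hα.le]
    · filter_upwards [hfar] with θ hθ hge
      have h1 := hθ hge
      have h2 : Real.log (L ω θstar) ≤ Real.log (L ω x) := Real.log_le_log (hL _) (hx _)
      rw [hw_def, ← mul_assoc]
      refine mul_le_mul_of_nonneg_right (le_trans ?_ (rpow_mul_exp_neg_log_le hc₀ hc₁ hr
        (by positivity) hkn hge)) (hprior0 θ)
      refine mul_le_mul_of_nonneg_left (Real.exp_le_exp.2 ?_) (by positivity)
      nlinarith [mul_le_mul_of_nonneg_left h1 hα.le, mul_le_mul_of_nonneg_left h2 hα.le]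
  have hdenpos : 0 < m * Real.exp (-c₃) * (s⁻¹ ^ p * V) := by positivity
  rw [integral_mul_post_eq hL x]
  calc (∫ θ, ‖s • (θ - θstar)‖ ^ k * w θ) / ∫ θ, w θ
      ≤ ((s ^ p)⁻¹ * (κ * I + 1)) / (m * Real.exp (-c₃) * (s⁻¹ ^ p * V)) := by
        refine div_le_div₀ (by positivity) (hnum.trans ?_) hdenpos hden
        rw [mul_add, mul_one, mul_left_comm]
        gcongr
        rwa [← one_div, le_div_iff₀' (by positivity)]
    _ = (κ * I + 1) / (m * Real.exp (-c₃) * V) := by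
        rw [inv_pow]
        field_simp

/-- Powers of `√x` are negligible against exponential decay in `x`. -/
theorem tendsto_sqrt_pow_mul_sqrt_rpow_mul_exp_neg (p : ℕ) (k C : ℝ) {b : ℝ} (hb : 0 < b) :
    Tendsto (fun x : ℝ => Real.sqrt x ^ p * (Real.sqrt x ^ k * (C * Real.exp (-(b * x)))))
      atTop (𝓝 0) := by
  have h := (tendsto_rpow_mul_exp_neg_mul_atTop_nhds_zero ((p + k) / 2) b hb).const_mul C
  rw [mul_zero] at h
  refine h.congr' ?_
  filter_upwards [eventually_gt_atTop 0] with x hx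
  have hsx : 0 < Real.sqrt x := Real.sqrt_pos.2 hx
  have h1 : x ^ ((p + k) / 2) = Real.sqrt x ^ p * Real.sqrt x ^ k := by
    rw [← Real.rpow_natCast, ← Real.rpow_add hsx, Real.sqrt_eq_rpow, ← Real.rpow_mul hx.le]
    ring_nf
  rw [h1, neg_mul]
  ring

/-- **Proposition C.2** (salience and local quadratic behavior of the likelihood imply
uniformly bounded posterior moments, i.e., sufficient conditions for (A3)). -/
theorem sufficient_conditions_for_A3
    {p : ℕ} {Ω : ℕ → Type} [∀ n, MeasurableSpace (Ω n)]
    (P : ∀ n, Measure (Ω n)) [∀ n, IsProbabilityMeasure (P n)]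
    (L : ∀ n, Ω n → EuclideanSpace ℝ (Fin p) → ℝ)
    (prior : EuclideanSpace ℝ (Fin p) → ℝ)
    (θhat : ∀ n, Ω n → EuclideanSpace ℝ (Fin p))
    (θstar : EuclideanSpace ℝ (Fin p))
    (α : ℕ → ℝ) (κ : ℝ)
    -- basic regularity of the model
    (hLmeas : ∀ n, Measurable (Function.uncurry (L n)))
    (hLpos : ∀ n ω θ, 0 < L n ω θ)
    (hpriormeas : Measurable prior)
    (hpriornn : ∀ θ, 0 ≤ prior θ)
    (hpriorint : ∫ θ, prior θ = 1)
    (hθmeas : ∀ n, Measurable (θhat n))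
    (hMLE : ∀ n ω θ, θ ≠ θhat n ω → L n ω θ < L n ω (θhat n ω))
    (hZ : ∀ n ω, Integrable (fun θ => L n ω θ ^ (α n) * prior θ) ∧
        0 < ∫ θ, L n ω θ ^ (α n) * prior θ)
    -- tempering sequence: `α n → 0` and `α n * n → ∞`
    (hαpos : ∀ n, 0 < α n)
    (hα0 : Tendsto α atTop (nhds 0))
    (hαn : Tendsto (fun n => α n * (n : ℝ)) atTop atTop)
    -- assumptions (A0), (A1), a bounded prior, and Conditions 1 and 2
    (hA0 : A0 P θhat θstar)
    (hA1 : A1 prior θstar)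
    (hκ : 0 < κ) (hpriorbd : ∀ θ, prior θ ≤ κ)
    (hConds : Conds12 P L θhat θstar) :
    A3 P L prior θstar α := by
  obtain ⟨Lc, c₀, c₁, c₂, r, γfun, hLc, hc₀, hc₁, -, hrlt, -, hγ, hC1, c₃, c₄, hc₃, hc₄, hC2⟩ :=
    hConds
  have hr : 0 < r := lt_trans (by positivity) hrlt
  have hτ : 0 < c₀ * Real.log (c₁ * r) - c₂ := by
    rw [div_lt_iff₀' hc₁, ← Real.lt_log_iff_exp_lt (by positivity), div_lt_iff₀' hc₀] at hrlt
    linarith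
  obtain ⟨δ₀, hδ₀, hcont, hpos⟩ := hA1
  have hps : 0 < prior θstar := hpos _ (Metric.mem_ball_self hδ₀)
  obtain ⟨δ, hδ, hδm⟩ := Metric.eventually_nhds_iff.1
    ((hcont.continuousAt (Metric.ball_mem_nhds _ hδ₀)).eventually_const_lt (half_lt_self hps))
  intro ε hε k hk
  have hε3 : 0 < ε / 3 := by positivity
  obtain ⟨R, hR, hRev⟩ := hA0.exists_eventually_measure_lt hθmeas hε3
  have hLθ : ∀ n, Measurable fun z : Ω n × EuclideanSpace ℝ (Fin p) => L n z.1 z.2 := hLmeas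
  have hLf : ∀ n (g : Ω n → EuclideanSpace ℝ (Fin p)), Measurable g →
      Measurable fun z : Ω n × EuclideanSpace ℝ (Fin p) => L n z.1 (g z.1) := fun n g hg =>
    (hLmeas n).comp (measurable_fst.prodMk (hg.comp measurable_fst))
  have hbad1 := tendsto_measure_not_ae_of_subset P volume
    (B := fun n => {z : Ω n × EuclideanSpace ℝ (Fin p) | r ≤ ‖z.2 - θstar‖ →
      Real.log (L n z.1 z.2) - Real.log (L n z.1 θstar) ≤
        -(Lc * (n : ℝ) * (c₀ * Real.log (1 + c₁ * ‖z.2 - θstar‖) - c₂))}) hC1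
    (fun n => by
      have h1 := hLθ n
      have h2 := hLf n (fun _ => θstar) measurable_const
      refine measurableSet_setOfPred.2 (Measurable.imp (measurableSet_setOfPred.1 ?_)
        (measurableSet_setOfPred.1 ?_))
      · exact measurableSet_le measurable_const (by fun_prop)
      · exact measurableSet_le (by fun_prop) (by fun_prop))
    (fun n ω hω θ hθ => (hω θ hθ).trans (neg_le_neg
      (mul_le_mul_of_nonneg_left (hγ _ hθ) (by positivity))))
  have hbad2 := tendsto_measure_not_ae_of_subset P volume
    (B := fun n => {z : Ω n × EuclideanSpace ℝ (Fin p) | ‖z.2 - θhat n z.1‖ < 2 * r →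
      -((n : ℝ) * c₃ * ‖z.2 - θhat n z.1‖ ^ 2) ≤
          Real.log (L n z.1 z.2) - Real.log (L n z.1 (θhat n z.1)) ∧
        Real.log (L n z.1 z.2) - Real.log (L n z.1 (θhat n z.1)) ≤
          -((n : ℝ) * c₄ * ‖z.2 - θhat n z.1‖ ^ 2)}) hC2
    (fun n => by
      have h1 := hLθ n
      have h2 := hLf n (θhat n) (hθmeas n)
      have h3 := hθmeas n
      refine measurableSet_setOfPred.2 (Measurable.imp (measurableSet_setOfPred.1 ?_)
        ((measurableSet_setOfPred.1 ?_).and (measurableSet_setOfPred.1 ?_)))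
      · exact measurableSet_lt (by fun_prop) measurable_const
      · exact measurableSet_le (by fun_prop) (by fun_prop)
      · exact measurableSet_le (by fun_prop) (by fun_prop))
    (fun n ω hω θ hθ => hω θ hθ)
  have hsqrt : Tendsto (fun n => Real.sqrt (α n * n)) atTop atTop :=
    Real.tendsto_sqrt_atTop.comp hαn
  have hRn : Tendsto (fun n : ℕ => R / Real.sqrt n) atTop (𝓝 0) :=
    (Real.tendsto_sqrt_atTop.comp tendsto_natCast_atTop_atTop).const_div_atTop R
  have hdec := (tendsto_sqrt_pow_mul_sqrt_rpow_mul_exp_neg p k (r ^ k)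
    (mul_pos hLc hτ)).comp hαn
  have hε3' : (0 : ENNReal) < ENNReal.ofReal (ε / 3) := ENNReal.ofReal_pos.2 hε3
  refine ⟨(κ * (∫ u : EuclideanSpace ℝ (Fin p), (‖u‖ + R) ^ k * Real.exp (-(c₄ * ‖u‖ ^ 2))) + 1) /
    (prior θstar / 2 * Real.exp (-c₃) *
      (volume : Measure (EuclideanSpace ℝ (Fin p))).real (Metric.ball 0 1)),
    exists_nat_forall_of_eventually hα0.bddAbove_range ?_⟩
  filter_upwards [hRev, hbad1.eventually_lt_const hε3', hbad2.eventually_lt_const hε3',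
    hα0.eventually_le_const zero_lt_one, hRn.eventually_lt_const hr,
    hRn.eventually_lt_const (half_pos hδ),
    hsqrt.inv_tendsto_atTop.eventually_lt_const (half_pos hδ),
    hsqrt.inv_tendsto_atTop.eventually_lt_const (mul_pos two_pos hr),
    hαn.eventually_ge_atTop (k / (Lc * c₀)), hdec.eventually_le_const zero_lt_one,
    eventually_gt_atTop 0] with n h1 h2 h3 hα1 hRr hRδ hsδ hsr hkn hdecn hn
  have hn0 : (0 : ℝ) < n := Nat.cast_pos.2 hn
  refine lt_of_le_of_lt ((measure_mono ?_).trans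
    ((measure_union_le _ _).trans (add_le_add_left (measure_union_le _ _) _)))
    ((ENNReal.add_lt_add (ENNReal.add_lt_add h1 h2) h3).trans_le ?_)
  · intro ω hω
    rw [Set.mem_ofPred_eq] at hω
    by_contra hgood
    simp only [Set.mem_union, Set.mem_ofPred_eq, not_or, not_not, not_lt] at hgood
    obtain ⟨⟨hωR, hωfar⟩, hωnear⟩ := hgood
    have hdist : ‖θhat n ω - θstar‖ ≤ R / Real.sqrt n :=
      (le_div_iff₀' (Real.sqrt_pos.2 hn0)).2 hωR
    refine hω.not_ge (integral_norm_rpow_mul_post_le (c₂ := c₂) (hLpos n ω) hpriornn hpriorint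
      hpriorbd hκ.le (half_pos hps) (fun θ hθ => (hδm (by rwa [dist_eq_norm])).le) (hZ n ω).1 (fun θ => ?_)
      (hαpos n) hn0 hk hR.le hLc hc₀ hc₁ hc₃ hc₄ hr ?_ (hdist.trans_lt hRr)
      (hdist.trans_lt hRδ) hsδ hsr ?_ ?_ hωfar hωnear)
    · rcases eq_or_ne θ (θhat n ω) with rfl | hne
      · exact le_rfl
      · exact (hMLE n ω θ hne).le
    · rw [Real.sqrt_mul (hαpos n).le, mul_assoc]
      exact (mul_le_of_le_one_left (by positivity) (Real.sqrt_le_one.2 hα1)).trans hωR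
    · rwa [div_le_iff₀ (by positivity), ← mul_assoc] at hkn
    · rwa [show α n * n * Lc * (c₀ * Real.log (c₁ * r) - c₂) =
        Lc * (c₀ * Real.log (c₁ * r) - c₂) * (α n * n) by ring]
  · rw [← ENNReal.ofReal_add hε3.le hε3.le, ← ENNReal.ofReal_add (by positivity) hε3.le]
    exact ENNReal.ofReal_le_ofReal (by linarith)
end
end
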